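/- arXiv:2403.13775 — 4 statements merged into one kernel-verified Lean document; each statement's English description precedes it below -/
import Mathlib

section
/- Let (A,φ) be a simple associative algebra with involution over a field F of characteristic different from 2 (not necessarily finite-dimensional), equipped with a nontrivial 3-grading Γ: A = A_{−1} ⊕ A_0 ⊕ A_1 such that φ(A_i) = A_{−i} for i = −1, 0, 1. Then either A_1 = 0 = A_{−1}, or A_0 = A_1A_{−1} ⊕ A_{−1}A_1 (internal direct sum of the two subspaces A_1A_{−1} and A_{−1}A_1 of A_0). -/
/-!
STATEMENT 1. Let (A,φ) be a simple associative algebra with involution over a field F of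
characteristic ≠ 2 (not necessarily unital nor finite-dimensional), with a nontrivial 3-grading
Γ : A = A₋₁ ⊕ A₀ ⊕ A₁ such that φ(Aᵢ) = A₋ᵢ.  Then either A₁ = 0 = A₋₁, or
A₀ = A₁A₋₁ ⊕ A₋₁A₁ (internal direct sum of the spans of products).

The 3-grading is encoded as a family `𝒜 : ℤ → Submodule F A` which is an internal direct sum,
vanishes outside {-1,0,1}, and satisfies 𝒜 i * 𝒜 j ⊆ 𝒜 (i+j).  For subspaces X Y we write
`mulSpan X Y` for the linear span of products, matching "XY denotes the linear span of products".
-/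

/-- The linear span of the set of products `x * y` with `x ∈ S`, `y ∈ T`. -/
def mulSpan {F A : Type*} [Field F] [NonUnitalRing A] [Module F A]
    (S T : Submodule F A) : Submodule F A :=
  Submodule.span F {z : A | ∃ x ∈ S, ∃ y ∈ T, z = x * y}

section mulSpan

variable {F A : Type*} [Field F] [NonUnitalRing A] [Module F A]

theorem mul_mem_mulSpan {S T : Submodule F A} {x y : A} (hx : x ∈ S) (hy : y ∈ T) :
    x * y ∈ mulSpan S T :=
  Submodule.subset_span ⟨x, hx, y, hy, rfl⟩

theorem mulSpan_le {S T P : Submodule F A} :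
    mulSpan S T ≤ P ↔ ∀ x ∈ S, ∀ y ∈ T, x * y ∈ P := by
  refine ⟨fun h x hx y hy => h (mul_mem_mulSpan hx hy), fun h => Submodule.span_le.2 ?_⟩
  rintro _ ⟨x, hx, y, hy, rfl⟩
  exact h x hx y hy

theorem mul_left_mem_of_mem_mulSpan [SMulCommClass F A A] {S T P : Submodule F A} {a z : A}
    (h : ∀ x ∈ S, ∀ y ∈ T, a * (x * y) ∈ P) (hz : z ∈ mulSpan S T) : a * z ∈ P := by
  have hle : mulSpan S T ≤ P.comap (LinearMap.mulLeft F a) := mulSpan_le.2 h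
  exact hle hz

theorem mul_right_mem_of_mem_mulSpan [IsScalarTower F A A] {S T P : Submodule F A} {a z : A}
    (h : ∀ x ∈ S, ∀ y ∈ T, x * y * a ∈ P) (hz : z ∈ mulSpan S T) : z * a ∈ P := by
  have hle : mulSpan S T ≤ P.comap (LinearMap.mulRight F a) := mulSpan_le.2 h
  exact hle hz

/-- The two-sided annihilator of a non-unital algebra. -/
def twoSidedAnnihilator (F A : Type*) [Field F] [NonUnitalRing A] [Module F A]
    [SMulCommClass F A A] [IsScalarTower F A A] : Submodule F A where
  carrier := {x | ∀ a, x * a = 0 ∧ a * x = 0}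
  add_mem' hx hy a := by simp [add_mul, mul_add, hx a, hy a]
  zero_mem' a := by simp
  smul_mem' c x hx a := by simp [smul_mul_assoc, mul_smul_comm, hx a]

end mulSpan

theorem stmt_1
    (F : Type*) [Field F] (hchar : ringChar F ≠ 2)
    (A : Type*) [NonUnitalRing A] [Module F A] [SMulCommClass F A A] [IsScalarTower F A A]
    -- the involution
    (φ : A →ₗ[F] A)
    (hφ₂ : ∀ a, φ (φ a) = a)
    (hφmul : ∀ a b, φ (a * b) = φ b * φ a)
    -- (A,φ) is simple: A² ≠ 0 and no nonzero proper φ-stable two-sided ideals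
    (hA2 : ∃ a b : A, a * b ≠ 0)
    (hsimple : ∀ I : Submodule F A,
      (∀ a : A, ∀ x ∈ I, a * x ∈ I ∧ x * a ∈ I) → (∀ x ∈ I, φ x ∈ I) →
      I = ⊥ ∨ I = ⊤)
    -- the 3-grading
    (𝒜 : ℤ → Submodule F A)
    (hinternal : DirectSum.IsInternal 𝒜)
    (hsupp : ∀ i : ℤ, i ≠ -1 → i ≠ 0 → i ≠ 1 → 𝒜 i = ⊥)
    (hmul : ∀ i j : ℤ, mulSpan (𝒜 i) (𝒜 j) ≤ 𝒜 (i + j))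
    -- the grading is nontrivial
    (hnontrivial : 𝒜 0 ≠ ⊤)
    -- compatibility of the involution with the grading: φ(Aᵢ) = A₋ᵢ
    (hφgr : ∀ i : ℤ, Submodule.map φ (𝒜 i) = 𝒜 (-i)) :
    (𝒜 1 = ⊥ ∧ 𝒜 (-1) = ⊥) ∨
      (𝒜 0 = mulSpan (𝒜 1) (𝒜 (-1)) ⊔ mulSpan (𝒜 (-1)) (𝒜 1) ∧
        mulSpan (𝒜 1) (𝒜 (-1)) ⊓ mulSpan (𝒜 (-1)) (𝒜 1) = ⊥) := by
  have hm : ∀ {i j : ℤ} (k : ℤ) {x y : A}, i + j = k → x ∈ 𝒜 i → y ∈ 𝒜 j → x * y ∈ 𝒜 k := by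
    rintro i j _ x y rfl hx hy
    exact hmul i j (mul_mem_mulSpan hx hy)
  have hp : ∀ {x y : A}, x ∈ 𝒜 1 → y ∈ 𝒜 1 → x * y = 0 := fun hx hy => by
    simpa [hsupp 2] using hm 2 (by norm_num) hx hy
  have hn : ∀ {x y : A}, x ∈ 𝒜 (-1) → y ∈ 𝒜 (-1) → x * y = 0 := fun hx hy => by
    simpa [hsupp (-2)] using hm (-2) (by norm_num) hx hy
  have hφp : ∀ {x : A}, x ∈ 𝒜 1 → φ x ∈ 𝒜 (-1) := fun hx =>
    hφgr 1 ▸ Submodule.mem_map_of_mem hx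
  have hφn : ∀ {x : A}, x ∈ 𝒜 (-1) → φ x ∈ 𝒜 1 := fun {x} hx => by
    have h := Submodule.mem_map_of_mem (f := φ) hx
    rwa [hφgr, neg_neg] at h
  have hind : ∀ P : Submodule F A, 𝒜 1 ≤ P → 𝒜 (-1) ≤ P → 𝒜 0 ≤ P → ∀ a, a ∈ P := by
    intro P h1 h2 h0 a
    have htop : ⨆ i, 𝒜 i ≤ P := iSup_le fun i => by
      by_cases hi : i = -1
      · exact hi ▸ h2
      by_cases hi' : i = 0
      · exact hi' ▸ h0
      by_cases hi'' : i = 1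
      · exact hi'' ▸ h1
      · simp [hsupp i hi hi' hi'']
    rw [hinternal.submodule_iSup_eq_top] at htop
    exact htop trivial
  by_cases h1 : 𝒜 1 = ⊥
  · refine Or.inl ⟨h1, ?_⟩
    rw [← hφgr 1, h1, Submodule.map_bot]
  right
  set M := mulSpan (𝒜 1) (𝒜 (-1))
  set N := mulSpan (𝒜 (-1)) (𝒜 1)
  have hM0 : M ≤ 𝒜 0 := hmul 1 (-1)
  have hN0 : N ≤ 𝒜 0 := hmul (-1) 1
  set I := 𝒜 1 ⊔ 𝒜 (-1) ⊔ (M ⊔ N)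
  have h1I : 𝒜 1 ≤ I := le_sup_left.trans le_sup_left
  have hnI : 𝒜 (-1) ≤ I := le_sup_right.trans le_sup_left
  have hMI : M ≤ I := le_sup_left.trans le_sup_right
  have hNI : N ≤ I := le_sup_right.trans le_sup_right
  have hleft : ∀ x ∈ I, ∀ a, a * x ∈ I := by
    intro x hx a
    refine (sup_le (sup_le ?_ ?_) (sup_le ?_ ?_) :
      I ≤ I.comap (LinearMap.mulLeft F a)) hx <;> clear hx x <;> intro x hx
    all_goals
      refine hind (I.comap (LinearMap.mulRight F x)) (fun a ha => ?_) (fun a ha => ?_)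
        (fun a ha => ?_) a
      all_goals change a * x ∈ I
    · simp [hp ha hx]
    · exact hNI (mul_mem_mulSpan ha hx)
    · exact h1I (hm 1 (by norm_num) ha hx)
    · exact hMI (mul_mem_mulSpan ha hx)
    · simp [hn ha hx]
    · exact hnI (hm (-1) (by norm_num) ha hx)
    · exact h1I (hm 1 (by norm_num) ha (hM0 hx))
    · exact hnI (hm (-1) (by norm_num) ha (hM0 hx))
    · refine hMI (mul_left_mem_of_mem_mulSpan (fun y hy z hz => ?_) hx)
      rw [← mul_assoc]
      exact mul_mem_mulSpan (hm 1 (by norm_num) ha hy) hz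
    · exact h1I (hm 1 (by norm_num) ha (hN0 hx))
    · exact hnI (hm (-1) (by norm_num) ha (hN0 hx))
    · refine hNI (mul_left_mem_of_mem_mulSpan (fun y hy z hz => ?_) hx)
      rw [← mul_assoc]
      exact mul_mem_mulSpan (hm (-1) (by norm_num) ha hy) hz
  have hφI : ∀ x ∈ I, φ x ∈ I := by
    intro x hx
    refine (sup_le (sup_le ?_ ?_) (sup_le ?_ ?_) : I ≤ I.comap φ) hx
    · exact fun x hx => hnI (hφp hx)
    · exact fun x hx => h1I (hφn hx)
    · refine mulSpan_le.2 fun x hx y hy => hMI ?_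
      rw [hφmul]
      exact mul_mem_mulSpan (hφn hy) (hφp hx)
    · refine mulSpan_le.2 fun x hx y hy => hNI ?_
      rw [hφmul]
      exact mul_mem_mulSpan (hφp hy) (hφn hx)
  have hright : ∀ x ∈ I, ∀ a, x * a ∈ I := fun x hx a => by
    have h := hφI _ (hleft _ (hφI x hx) (φ a))
    rwa [← hφmul, hφ₂] at h
  have hItop : I = ⊤ :=
    (hsimple I (fun a x hx => ⟨hleft x hx a, hright x hx a⟩) hφI).resolve_left
      fun h => h1 (le_bot_iff.1 (h ▸ h1I))
  constructor
  · refine le_antisymm (fun x hx => ?_) (sup_le hM0 hN0)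
    have hxI : x ∈ I := hItop ▸ Submodule.mem_top
    obtain ⟨p, hpm, q, hq, rfl⟩ := Submodule.mem_sup.1 hxI
    have hp0 : p ∈ 𝒜 0 := by
      simpa using (𝒜 0).sub_mem hx (sup_le hM0 hN0 hq)
    have hle : 𝒜 1 ⊔ 𝒜 (-1) ≤ ⨆ j ≠ (0 : ℤ), 𝒜 j :=
      sup_le (le_iSup₂_of_le 1 one_ne_zero le_rfl)
        (le_iSup₂_of_le (-1) (by norm_num) le_rfl)
    rw [Submodule.disjoint_def.1 (hinternal.submodule_iSupIndep 0) p hp0 (hle hpm), zero_add]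
    exact hq
  · have hann : twoSidedAnnihilator F A = ⊥ := by
      refine (hsimple (twoSidedAnnihilator F A) (fun a x hx => ?_)
        (fun x hx a => ?_)).resolve_right fun h => ?_
      · simp [(hx a).1, (hx a).2]
      · rw [← hφ₂ a, ← hφmul, ← hφmul, (hx (φ a)).1, (hx (φ a)).2]
        simp
      · obtain ⟨a, b, hab⟩ := hA2
        have ha : a ∈ twoSidedAnnihilator F A := h ▸ Submodule.mem_top
        exact hab (ha b).1
    rw [← le_bot_iff, ← hann]
    rintro x ⟨hxM, hxN⟩
    have e1 : ∀ a ∈ 𝒜 1, x * a = 0 ∧ a * x = 0 := fun a ha => by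
      refine ⟨(Submodule.mem_bot F).1 (mul_right_mem_of_mem_mulSpan (fun y _ z hz => ?_) hxN),
        (Submodule.mem_bot F).1 (mul_left_mem_of_mem_mulSpan (fun y hy z _ => ?_) hxM)⟩
      · simp [mul_assoc, hp hz ha]
      · simp [← mul_assoc, hp ha hy]
    have e2 : ∀ a ∈ 𝒜 (-1), x * a = 0 ∧ a * x = 0 := fun a ha => by
      refine ⟨(Submodule.mem_bot F).1 (mul_right_mem_of_mem_mulSpan (fun y _ z hz => ?_) hxM),
        (Submodule.mem_bot F).1 (mul_left_mem_of_mem_mulSpan (fun y hy z _ => ?_) hxN)⟩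
      · simp [mul_assoc, hn hz ha]
      · simp [← mul_assoc, hn ha hy]
    let K : Submodule F A :=
      LinearMap.ker (LinearMap.mulLeft F x) ⊓ LinearMap.ker (LinearMap.mulRight F x)
    have hMK : M ≤ K := mulSpan_le.2 fun y hy z hz =>
      ⟨by simp [← mul_assoc, (e1 y hy).1], by simp [mul_assoc, (e2 z hz).2]⟩
    have hNK : N ≤ K := mulSpan_le.2 fun y hy z hz =>
      ⟨by simp [← mul_assoc, (e2 y hy).1], by simp [mul_assoc, (e1 z hz).2]⟩
    have hIK : I ≤ K := sup_le (sup_le e1 e2) (sup_le hMK hNK)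
    exact fun a => hIK (hItop ▸ Submodule.mem_top)
end

section
/- Let G be a finitely generated abelian group and let (A,φ,Γ) satisfy: (A,φ) is a finite-dimensional simple associative algebra with involution over a field F of characteristic different from 2, Γ is a (ℤ×G)-grading of A with φ(A_{(i,g)}) = A_{(−i,g)} for all (i,g), and the support of the induced ℤ-grading is {−1,0,1}. If (A,Γ) is not graded-simple, then there exist a simple associative algebra I and a (ℤ×G)-grading Γ_I on I whose induced ℤ-grading has support {−1,0,1}, such that (A,φ,Γ) ≅ (I ⊕ I^op, ex, Γ_I^ex), where ex is the exchange involution and Γ_I^ex is the exchange grading. -/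
universe u v w

/-!
STATEMENT 7.  Let G be a finitely generated abelian group and (A,φ,Γ) a finite-dimensional
simple associative algebra with involution over F (char F ≠ 2) with a (ℤ×G)-grading Γ such
that φ(A₍ᵢ,g₎) = A₍₋ᵢ,g₎ and the induced ℤ-grading has support {−1,0,1}.  If (A,Γ) is not
graded-simple then (A,φ,Γ) ≅ (I ⊕ I^op, ex, Γ_I^ex) for some simple algebra I with a
(ℤ×G)-grading Γ_I with induced ℤ-support {−1,0,1}.
-/

/-- Packaged (ℤ×G)-graded algebra: a carrier with an `F`-algebra structure and a family of
subspaces indexed by `ι`. -/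
structure GrAlg (F : Type u) [Field F] (ι : Type v) : Type (max u v (w + 1)) where
  carrier : Type w
  [ring : Ring carrier]
  [alg : Algebra F carrier]
  gr : ι → Submodule F carrier

attribute [instance] GrAlg.ring GrAlg.alg

/-- The exchange involution `(x,y) ↦ (y,x)` on `A ⊕ A^op`. -/
def exInv (F : Type u) [Field F] (A : Type w) [Ring A] [Algebra F A] :
    (A × Aᵐᵒᵖ) →ₗ[F] (A × Aᵐᵒᵖ) :=
  (((MulOpposite.opLinearEquiv F).symm.toLinearMap).comp (LinearMap.snd F A Aᵐᵒᵖ)).prod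
    (((MulOpposite.opLinearEquiv F).toLinearMap).comp (LinearMap.fst F A Aᵐᵒᵖ))

/-- The exchange grading on `A ⊕ A^op`:
`(A ⊕ A^op)₍ᵢ,g₎ = {(x,y) : x ∈ A₍ᵢ,g₎, y ∈ A₍₋ᵢ,g₎}`. -/
def exGr {F : Type u} [Field F] {G : Type v} [CommGroup G] {A : Type w} [Ring A] [Algebra F A]
    (Γ : ℤ × G → Submodule F A) : ℤ × G → Submodule F (A × Aᵐᵒᵖ) :=
  fun p => (Γ p).prod ((Γ (-p.1, p.2)).map (MulOpposite.opLinearEquiv F).toLinearMap)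

/-- A two-sided ideal of an algebra is the kernel of a surjective algebra homomorphism. -/
theorem exists_algHom_surjective_eq_zero_iff_mem {F : Type u} [Field F] {A : Type w} [Ring A]
    [Algebra F A] (N : Submodule F A) (hN : ∀ a : A, ∀ x ∈ N, a * x ∈ N ∧ x * a ∈ N) :
    ∃ (B : Type w) (_ : Ring B) (_ : Algebra F B) (π : A →ₐ[F] B),
      Function.Surjective π ∧ ∀ x, π x = 0 ↔ x ∈ N := by
  let T : TwoSidedIdeal A := TwoSidedIdeal.mk' (N : Set A) N.zero_mem (fun hx hy => N.add_mem hx hy)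
    (fun hx => N.neg_mem hx) (fun {x y} hy => (hN x y hy).1) (fun {x y} hx => (hN y x hx).2)
  refine ⟨T.ringCon.Quotient, inferInstance, inferInstance, T.ringCon.mkₐ F,
    T.ringCon.mkₐ_surjective, fun x => ?_⟩
  have h : T.ringCon.mkₐ F x = 0 ↔ T.ringCon x 0 := RingCon.eq T.ringCon
  rw [h, ← TwoSidedIdeal.mem_iff, TwoSidedIdeal.mem_mk']
  rfl

/-- An internal direct sum decomposition has a family of projections. -/
theorem DirectSum.IsInternal.exists_proj {R M ι : Type*} [DecidableEq ι] [Ring R] [AddCommGroup M]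
    [Module R M] {W : ι → Submodule R M} (hW : DirectSum.IsInternal W) :
    ∃ P : ι → M →ₗ[R] M, (∀ p x, P p x ∈ W p) ∧ (∀ p, ∀ x ∈ W p, P p x = x) ∧
      ∀ p q, ∀ x ∈ W q, q ≠ p → P p x = 0 := by
  let _ := hW.chooseDecomposition
  refine ⟨fun p => (W p).subtype ∘ₗ DirectSum.component R ι (fun i => W i) p ∘ₗ
    (DirectSum.decomposeLinearEquiv W).toLinearMap, fun p x => ?_, fun p x hx => ?_,
    fun p q x hx hqp => ?_⟩
  · exact Subtype.coe_prop _
  · exact DirectSum.decompose_of_mem_same W hx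
  · exact DirectSum.decompose_of_mem_ne W hx hqp

/-- A graded subspace is stable under the projections of the grading. -/
theorem proj_mem_of_le_iSup_inf {R M ι : Type*} [Ring R] [AddCommGroup M] [Module R M]
    {W : ι → Submodule R M} {P : ι → M →ₗ[R] M} (hP : ∀ p, ∀ x ∈ W p, P p x = x)
    (hP' : ∀ p q, ∀ x ∈ W q, q ≠ p → P p x = 0) {J : Submodule R M}
    (hJ : J ≤ ⨆ p, J ⊓ W p) (p : ι) {x : M} (hx : x ∈ J) : P p x ∈ J := by
  have h : (⨆ q, J ⊓ W q) ≤ J.comap (P p) := by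
    refine iSup_le fun q y hy => ?_
    by_cases hqp : q = p
    · subst hqp
      simpa [hP q y hy.2] using hy.1
    · simp [hP' p q y hy.2 hqp]
  exact h (hJ hx)

/-- The image of a grading under a surjective linear map with graded kernel is a grading. -/
theorem DirectSum.IsInternal.map_of_graded_ker {R M N ι : Type*} [DecidableEq ι] [Ring R]
    [AddCommGroup M] [Module R M] [AddCommGroup N] [Module R N] {W : ι → Submodule R M}
    (hW : DirectSum.IsInternal W) (f : M →ₗ[R] N) (hf : Function.Surjective f)
    (hker : LinearMap.ker f ≤ ⨆ p, LinearMap.ker f ⊓ W p) :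
    DirectSum.IsInternal fun p => (W p).map f := by
  obtain ⟨P, -, hP, hP'⟩ := hW.exists_proj
  refine DirectSum.isInternal_submodule_of_iSupIndep_of_iSup_eq_top ?_ ?_
  · rw [iSupIndep_def]
    intro p
    rw [Submodule.disjoint_def]
    rintro _ ⟨x, hx, rfl⟩ hx'
    simp only [← Submodule.map_iSup] at hx'
    obtain ⟨y, hy, hyx⟩ := hx'
    have hy0 : P p y = 0 := by
      have h : (⨆ (q) (_ : q ≠ p), W q) ≤ LinearMap.ker (P p) :=
        iSup₂_le fun q hq z hz => hP' p q z hz hq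
      exact h hy
    have hmem : x - y ∈ LinearMap.ker f := by simp [hyx]
    have := proj_mem_of_le_iSup_inf hP hP' hker p hmem
    simpa [hP p x hx, hy0] using this
  · rw [← Submodule.map_iSup, hW.submodule_iSup_eq_top, Submodule.map_top,
      LinearMap.range_eq_top.2 hf]

/-- If a graded simple unital algebra has ℤ-support in `{-1, 0, 1}` and one of the two extreme
components vanishes, so does the other. -/
theorem eq_bot_of_forall_neg_eq_bot {F : Type u} [Field F] {G : Type v} [CommGroup G] {B : Type w}
    [Ring B] [Nontrivial B] [Algebra F B]
    (hB : ∀ J : Submodule F B, (∀ a : B, ∀ x ∈ J, a * x ∈ J ∧ x * a ∈ J) → J = ⊥ ∨ J = ⊤)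
    {W : ℤ × G → Submodule F B} (htop : ⨆ p, W p = ⊤)
    (hmul : ∀ p q : ℤ × G, ∀ x ∈ W p, ∀ y ∈ W q, x * y ∈ W (p.1 + q.1, p.2 * q.2))
    (hsupp : ∀ p : ℤ × G, W p ≠ ⊥ → p.1 = -1 ∨ p.1 = 0 ∨ p.1 = 1)
    {s : ℤ} (hs : s = 1 ∨ s = -1) (hneg : ∀ g, W (-s, g) = ⊥) (g : G) : W (s, g) = ⊥ := by
  have hzero : ∀ g, W (s + s, g) = ⊥ := fun g => by
    by_contra h
    have := hsupp _ h
    simp only at this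
    omega
  have hcases : ∀ p : ℤ × G, W p = ⊥ ∨ p.1 = 0 ∨ p.1 = s := by
    rintro ⟨i, h⟩
    by_cases hi : i = -s
    · exact Or.inl (hi ▸ hneg h)
    · by_contra! hc
      have := hsupp _ hc.1
      have := hc.2
      simp only at *
      omega
  set K : Submodule F B := ⨆ h, W (s, h) with hK
  have hle : ∀ h, W (s, h) ≤ K := le_iSup (fun h => W (s, h))
  have hleft : ∀ a : B, ∀ h, ∀ x ∈ W (s, h), a * x ∈ K ∧ x * a ∈ K := by
    intro a h x hx
    have ha : a ∈ ⨆ p, W p := htop ▸ Submodule.mem_top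
    induction ha using Submodule.iSup_induction' with
    | mem p a ha =>
      rcases hcases p with hp | hp | hp
      · rw [hp, Submodule.mem_bot] at ha
        simp [ha]
      · have h₁ := hmul _ _ _ ha _ hx
        have h₂ := hmul _ _ _ hx _ ha
        simp only [hp, zero_add, add_zero] at h₁ h₂
        exact ⟨hle _ h₁, hle _ h₂⟩
      · have h₁ := hmul _ _ _ ha _ hx
        have h₂ := hmul _ _ _ hx _ ha
        simp only [hp, hzero, Submodule.mem_bot] at h₁ h₂
        simp [h₁, h₂]
    | zero => simp
    | add a b _ _ h₁ h₂ =>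
      rw [add_mul, mul_add]
      exact ⟨K.add_mem h₁.1 h₂.1, K.add_mem h₁.2 h₂.2⟩
  have hideal : ∀ a : B, ∀ x ∈ K, a * x ∈ K ∧ x * a ∈ K := by
    intro a x hx
    induction hx using Submodule.iSup_induction' with
    | mem h x hx => exact hleft a h x hx
    | zero => simp
    | add x y _ _ h₁ h₂ =>
      rw [add_mul, mul_add]
      exact ⟨K.add_mem h₁.1 h₂.1, K.add_mem h₁.2 h₂.2⟩
  rcases hB K hideal with hbot | htop'
  · exact le_bot_iff.1 (hbot ▸ hle g)
  · have hsq : ∀ h, ∀ x ∈ W (s, h), ∀ y ∈ K, x * y = 0 := by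
      intro h x hx y hy
      induction hy using Submodule.iSup_induction' with
      | mem k y hy => simpa [hzero] using hmul _ _ _ hx _ hy
      | zero => simp
      | add y z _ _ h₁ h₂ => rw [mul_add, h₁, h₂, add_zero]
    rw [Submodule.eq_bot_iff]
    intro x hx
    simpa using hsq g x hx 1 (htop' ▸ Submodule.mem_top)

/-- If `J ⊕ φ(J)` is the whole algebra, the projection `π` with kernel `φ(J)` identifies
`(A, φ)` with the exchange algebra of `A / φ(J)`. -/
theorem exists_algEquiv_exchange {F : Type u} [Field F] {A B : Type w} [Ring A] [Algebra F A]
    [Ring B] [Algebra F B] (φ : A →ₗ[F] A) (hφ₂ : ∀ a, φ (φ a) = a)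
    (hφmul : ∀ a b, φ (a * b) = φ b * φ a) (π : A →ₐ[F] B) (hπ : Function.Surjective π)
    {J : Submodule F A} (hker : ∀ x, π x = 0 ↔ x ∈ J.map φ)
    (hcompl : IsCompl J (J.map φ)) :
    ∃ e : A ≃ₐ[F] (B × Bᵐᵒᵖ), ∀ x, e x = (π x, MulOpposite.op (π (φ x))) := by
  have hφ1 : φ 1 = 1 := by
    have h := hφmul (φ 1) 1
    rwa [mul_one, hφ₂, mul_one, eq_comm] at h
  have hmemJ : ∀ x, φ x ∈ J.map φ ↔ x ∈ J := fun x =>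
    ⟨fun ⟨y, hy, hyx⟩ => by rwa [← hφ₂ x, ← hyx, hφ₂], fun hx => ⟨x, hx, rfl⟩⟩
  let ψ : A →ₐ[F] Bᵐᵒᵖ := AlgHom.ofLinearMap
    ((MulOpposite.opLinearEquiv F).toLinearMap ∘ₗ π.toLinearMap ∘ₗ φ)
    (by simp [hφ1]) (by simp [hφmul])
  refine ⟨AlgEquiv.ofBijective (π.prod ψ) ⟨?_, ?_⟩, fun x => rfl⟩
  · rw [injective_iff_map_eq_zero]
    intro x hx
    have h₁ : π x = 0 := congrArg Prod.fst hx
    have h₂ : π (φ x) = 0 := congrArg (fun z => MulOpposite.unop (Prod.snd z)) hx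
    rw [hker] at h₁ h₂
    exact Submodule.disjoint_def.1 hcompl.disjoint x ((hmemJ x).1 h₂) h₁
  · rintro ⟨u, v⟩
    obtain ⟨a, rfl⟩ := hπ u
    obtain ⟨b, hb⟩ := hπ v.unop
    have hsum : ∀ a : A, ∃ y ∈ J, ∃ z ∈ J.map φ, y + z = a := fun a =>
      Submodule.mem_sup.1 (hcompl.sup_eq_top ▸ Submodule.mem_top)
    obtain ⟨y, hy, z, hz, rfl⟩ := hsum a
    obtain ⟨y', hy', z', hz', hb'⟩ := hsum (φ b)
    refine ⟨y + z', Prod.ext ?_ ?_⟩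
    · have h₁ := (hker z).2 hz
      have h₂ := (hker z').2 hz'
      change π (y + z') = π (y + z)
      rw [map_add, map_add, h₁, h₂]
    · have h₁ := (hker _).2 ((hmemJ y).2 hy)
      have h₂ := (hker _).2 ((hmemJ y').2 hy')
      change MulOpposite.op (π (φ (y + z'))) = v
      have hb'' : b = φ y' + φ z' := by rw [← map_add, hb', hφ₂]
      rw [← MulOpposite.op_unop v, ← hb, hb'', map_add, map_add, map_add, h₁, h₂]

/-- In an algebra with simple involution `φ`, a proper nonzero two-sided ideal `J` satisfies
`A = J ⊕ φ(J)`. -/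
theorem isCompl_map_involution {F : Type u} [Field F] {A : Type w} [Ring A] [Algebra F A]
    (φ : A →ₗ[F] A) (hφ₂ : ∀ a, φ (φ a) = a) (hφmul : ∀ a b, φ (a * b) = φ b * φ a)
    (hsimple : ∀ I : Submodule F A,
      (∀ a : A, ∀ x ∈ I, a * x ∈ I ∧ x * a ∈ I) → (∀ x ∈ I, φ x ∈ I) → I = ⊥ ∨ I = ⊤)
    {J : Submodule F A} (hJ : ∀ a : A, ∀ x ∈ J, a * x ∈ J ∧ x * a ∈ J) (hbot : J ≠ ⊥)
    (htop : J ≠ ⊤) :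
    (∀ a : A, ∀ x ∈ J.map φ, a * x ∈ J.map φ ∧ x * a ∈ J.map φ) ∧ IsCompl J (J.map φ) := by
  have hφJ : ∀ a : A, ∀ x ∈ J.map φ, a * x ∈ J.map φ ∧ x * a ∈ J.map φ := by
    rintro a _ ⟨x, hx, rfl⟩
    have h := hJ (φ a) x hx
    exact ⟨⟨x * φ a, h.2, by rw [hφmul, hφ₂]⟩, ⟨φ a * x, h.1, by rw [hφmul, hφ₂]⟩⟩
  refine ⟨hφJ, disjoint_iff.2 ?_, codisjoint_iff.2 ?_⟩
  · refine (hsimple (J ⊓ J.map φ) (fun a x hx => ⟨⟨(hJ a x hx.1).1, (hφJ a x hx.2).1⟩,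
      ⟨(hJ a x hx.1).2, (hφJ a x hx.2).2⟩⟩) ?_).resolve_right fun h => htop ?_
    · rintro _ ⟨hx, y, hy, rfl⟩
      exact ⟨by rwa [hφ₂], Submodule.mem_map_of_mem hx⟩
    · exact top_le_iff.1 (h ▸ inf_le_left)
  · refine (hsimple (J ⊔ J.map φ) (fun a x hx => ?_) ?_).resolve_left fun h => hbot ?_
    · obtain ⟨y, hy, z, hz, rfl⟩ := Submodule.mem_sup.1 hx
      rw [mul_add, add_mul]
      exact ⟨Submodule.add_mem_sup (hJ a y hy).1 (hφJ a z hz).1,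
        Submodule.add_mem_sup (hJ a y hy).2 (hφJ a z hz).2⟩
    · intro x hx
      obtain ⟨y, hy, _, ⟨z, hz, rfl⟩, rfl⟩ := Submodule.mem_sup.1 hx
      rw [map_add, hφ₂, add_comm]
      exact Submodule.add_mem_sup hz (Submodule.mem_map_of_mem hy)
    · exact le_bot_iff.1 (h ▸ le_sup_left)

/-- In the situation of `isCompl_map_involution`, `A / φ(J)` is simple. -/
theorem simple_of_ker_eq_map_involution {F : Type u} [Field F] {A B : Type w} [Ring A]
    [Algebra F A] [Ring B] [Algebra F B] (φ : A →ₗ[F] A) (hφ₂ : ∀ a, φ (φ a) = a)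
    (hφmul : ∀ a b, φ (a * b) = φ b * φ a)
    (hsimple : ∀ I : Submodule F A,
      (∀ a : A, ∀ x ∈ I, a * x ∈ I ∧ x * a ∈ I) → (∀ x ∈ I, φ x ∈ I) → I = ⊥ ∨ I = ⊤)
    (π : A →ₐ[F] B) (hπ : Function.Surjective π) {J : Submodule F A} (hbot : J ≠ ⊥)
    (hker : ∀ x, π x = 0 ↔ x ∈ J.map φ) (hcompl : IsCompl J (J.map φ)) (K : Submodule F B)
    (hK : ∀ a : B, ∀ x ∈ K, a * x ∈ K ∧ x * a ∈ K) : K = ⊥ ∨ K = ⊤ := by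
  set M : Submodule F A := K.comap π.toLinearMap with hM
  have hmap : M.map π.toLinearMap = K := Submodule.map_comap_eq_of_surjective hπ K
  by_cases htop : M = ⊤
  · right
    rw [← hmap, htop, Submodule.map_top, LinearMap.range_eq_top.2 hπ]
  have hφJM : J.map φ ≤ M := fun x hx => by
    have : π x ∈ K := by simp [(hker x).2 hx]
    exact this
  have hMbot : M ≠ ⊥ := by
    intro h
    refine hbot ((Submodule.eq_bot_iff _).2 fun x hx => ?_)
    have h0 : φ x ∈ M := hφJM (Submodule.mem_map_of_mem hx)
    rw [h, Submodule.mem_bot] at h0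
    rw [← hφ₂ x, h0, map_zero]
  have hMideal : ∀ a : A, ∀ x ∈ M, a * x ∈ M ∧ x * a ∈ M := fun a x hx => by
    have := hK (π a) (π x) hx
    rwa [← map_mul, ← map_mul] at this
  obtain ⟨-, hc⟩ := isCompl_map_involution φ hφ₂ hφmul hsimple hMideal hMbot htop
  have hJM : J ≤ M.map φ := fun x hx =>
    ⟨φ x, hφJM (Submodule.mem_map_of_mem hx), hφ₂ x⟩
  left
  rw [← hmap, Submodule.eq_bot_iff]
  rintro _ ⟨m, hm, rfl⟩
  obtain ⟨y, hy, z, hz, rfl⟩ := Submodule.mem_sup.1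
    (hcompl.sup_eq_top ▸ Submodule.mem_top : m ∈ J ⊔ J.map φ)
  have hyM : y ∈ M := by simpa using M.sub_mem hm (hφJM hz)
  rw [Submodule.disjoint_def.1 hc.disjoint y hyM (hJM hy), zero_add]
  exact (hker z).2 hz

theorem stmt_7
    (F : Type u) [Field F] (hchar : ringChar F ≠ 2)
    (G : Type v) [CommGroup G] [DecidableEq G] (hG : Group.FG G)
    (A : Type w) [Ring A] [Algebra F A] [FiniteDimensional F A]
    -- the involution
    (φ : A →ₗ[F] A)
    (hφ₂ : ∀ a, φ (φ a) = a)
    (hφmul : ∀ a b, φ (a * b) = φ b * φ a)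
    -- (A,φ) is simple
    (hA2 : ∃ a b : A, a * b ≠ 0)
    (hsimple : ∀ I : Submodule F A,
      (∀ a : A, ∀ x ∈ I, a * x ∈ I ∧ x * a ∈ I) → (∀ x ∈ I, φ x ∈ I) →
      I = ⊥ ∨ I = ⊤)
    -- the (ℤ×G)-grading Γ
    (Γ : ℤ × G → Submodule F A)
    (hinternal : DirectSum.IsInternal Γ)
    (hone : (1 : A) ∈ Γ (0, 1))
    (hgrmul : ∀ p q : ℤ × G, ∀ x ∈ Γ p, ∀ y ∈ Γ q, x * y ∈ Γ (p.1 + q.1, p.2 * q.2))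
    -- compatibility of the involution: φ(A₍ᵢ,g₎) = A₍₋ᵢ,g₎
    (hφgr : ∀ p : ℤ × G, Submodule.map φ (Γ p) = Γ (-p.1, p.2))
    -- the support of the induced ℤ-grading is {−1,0,1}
    (hsupp₁ : ∀ p : ℤ × G, Γ p ≠ ⊥ → p.1 = -1 ∨ p.1 = 0 ∨ p.1 = 1)
    (hsupp₂ : ∃ g : G, Γ (-1, g) ≠ ⊥)
    (hsupp₃ : ∃ g : G, Γ (0, g) ≠ ⊥)
    (hsupp₄ : ∃ g : G, Γ (1, g) ≠ ⊥)
    -- (A,Γ) is not graded-simple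
    (hngs : ¬ (∀ J : Submodule F A, (∀ a : A, ∀ x ∈ J, a * x ∈ J ∧ x * a ∈ J) →
      J ≤ ⨆ p : ℤ × G, ((J ⊓ Γ p : Submodule F A)) → J = ⊥ ∨ J = ⊤)) :
    -- conclusion
    ∃ I : GrAlg.{u, v, w} F (ℤ × G),
      -- I is a simple algebra
      Nontrivial I.carrier ∧
      (∀ J : Submodule F I.carrier,
        (∀ a : I.carrier, ∀ x ∈ J, a * x ∈ J ∧ x * a ∈ J) → J = ⊥ ∨ J = ⊤) ∧
      -- Γ_I is a (ℤ×G)-grading of I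
      DirectSum.IsInternal I.gr ∧
      ((1 : I.carrier) ∈ I.gr (0, 1)) ∧
      (∀ p q : ℤ × G, ∀ x ∈ I.gr p, ∀ y ∈ I.gr q, x * y ∈ I.gr (p.1 + q.1, p.2 * q.2)) ∧
      -- whose induced ℤ-grading has support {−1,0,1}
      (∀ p : ℤ × G, I.gr p ≠ ⊥ → p.1 = -1 ∨ p.1 = 0 ∨ p.1 = 1) ∧
      (∃ g : G, I.gr (-1, g) ≠ ⊥) ∧ (∃ g : G, I.gr (0, g) ≠ ⊥) ∧ (∃ g : G, I.gr (1, g) ≠ ⊥) ∧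
      -- and (A,φ,Γ) ≅ (I ⊕ I^op, ex, Γ_I^ex)
      ∃ e : A ≃ₐ[F] (I.carrier × I.carrierᵐᵒᵖ),
        (∀ x : A, e (φ x) = exInv F I.carrier (e x)) ∧
        (∀ p : ℤ × G, Submodule.map (e : A →ₗ[F] (I.carrier × I.carrierᵐᵒᵖ)) (Γ p)
            = exGr I.gr p) := by
  push Not at hngs
  obtain ⟨J, hJ, hJgr, hbot, htop⟩ := hngs
  obtain ⟨hφJ, hcompl⟩ := isCompl_map_involution φ hφ₂ hφmul hsimple hJ hbot htop
  obtain ⟨B, _, _, π, hπ, hker⟩ := exists_algHom_surjective_eq_zero_iff_mem (J.map φ) hφJ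
  have hBsimple := simple_of_ker_eq_map_involution φ hφ₂ hφmul hsimple π hπ hbot hker hcompl
  obtain ⟨e, he⟩ := exists_algEquiv_exchange φ hφ₂ hφmul π hπ hker hcompl
  have hmemφ : ∀ p : ℤ × G, ∀ x ∈ Γ p, φ x ∈ Γ (-p.1, p.2) := fun p x hx =>
    hφgr p ▸ Submodule.mem_map_of_mem hx
  have hmemφ' : ∀ p : ℤ × G, ∀ x ∈ Γ (-p.1, p.2), φ x ∈ Γ p := fun p x hx => by
    simpa using hmemφ _ x hx
  have hkerφ : LinearMap.ker π.toLinearMap = J.map φ := Submodule.ext hker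
  have hφJgr : J.map φ ≤ ⨆ p, J.map φ ⊓ Γ p := by
    rw [Submodule.map_le_iff_le_comap]
    refine hJgr.trans (iSup_le fun p x hx => ?_)
    exact Submodule.mem_iSup_of_mem (-p.1, p.2) ⟨Submodule.mem_map_of_mem hx.1, hmemφ p x hx.2⟩
  have hWint : DirectSum.IsInternal fun p => (Γ p).map π.toLinearMap :=
    hinternal.map_of_graded_ker _ hπ (hkerφ ▸ hφJgr)
  have hWone : (1 : B) ∈ (Γ (0, 1)).map π.toLinearMap := ⟨1, hone, map_one π⟩
  have hWmul : ∀ p q : ℤ × G, ∀ x ∈ (Γ p).map π.toLinearMap, ∀ y ∈ (Γ q).map π.toLinearMap,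
      x * y ∈ (Γ (p.1 + q.1, p.2 * q.2)).map π.toLinearMap := by
    rintro p q _ ⟨x, hx, rfl⟩ _ ⟨y, hy, rfl⟩
    exact ⟨x * y, hgrmul p q x hx y hy, map_mul π x y⟩
  have hWsupp : ∀ p : ℤ × G, (Γ p).map π.toLinearMap ≠ ⊥ → p.1 = -1 ∨ p.1 = 0 ∨ p.1 = 1 :=
    fun p hp => hsupp₁ p fun h => hp (by rw [h, Submodule.map_bot])
  have hnt : Nontrivial B := by
    by_contra h
    rw [not_nontrivial_iff_subsingleton] at h
    obtain ⟨a, b, hab⟩ := hA2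
    exact hab (e.injective (Subsingleton.elim _ _))
  have hext : ∀ s : ℤ, s = 1 ∨ s = -1 → ∃ g, (Γ (s, g)).map π.toLinearMap ≠ ⊥ := by
    intro s hs
    by_contra! hzero
    have hzero' : ∀ g, (Γ (-s, g)).map π.toLinearMap = ⊥ := fun g =>
      eq_bot_of_forall_neg_eq_bot hBsimple hWint.submodule_iSup_eq_top hWmul hWsupp
        (by omega) (by simpa using hzero) g
    obtain ⟨g, hg⟩ : ∃ g, Γ (s, g) ≠ ⊥ := by rcases hs with rfl | rfl <;> assumption
    refine hg ((Submodule.eq_bot_iff _).2 fun x hx => e.injective ?_)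
    have h₁ : π x ∈ (Γ (s, g)).map π.toLinearMap := ⟨x, hx, rfl⟩
    have h₂ : π (φ x) ∈ (Γ (-s, g)).map π.toLinearMap := ⟨φ x, hmemφ _ x hx, rfl⟩
    rw [hzero, Submodule.mem_bot] at h₁
    rw [hzero', Submodule.mem_bot] at h₂
    rw [he, h₁, h₂, map_zero]
    rfl
  refine ⟨⟨B, fun p => (Γ p).map π.toLinearMap⟩, hnt, hBsimple, hWint, hWone, hWmul, hWsupp,
    hext _ (Or.inr rfl), ⟨1, fun h => one_ne_zero ((Submodule.eq_bot_iff _).1 h 1 hWone)⟩,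
    hext _ (Or.inl rfl), e, fun x => ?_, fun p => le_antisymm ?_ ?_⟩
  · rw [he, he, hφ₂]
    rfl
  · rintro _ ⟨x, hx, rfl⟩
    change e x ∈ _
    rw [he]
    exact ⟨⟨x, hx, rfl⟩, π (φ x), ⟨φ x, hmemφ p x hx, rfl⟩, rfl⟩
  · rintro ⟨_, _⟩ ⟨⟨a, ha, rfl⟩, _, ⟨b, hb, rfl⟩, hb'⟩
    obtain ⟨P, hPmem, hP, hP'⟩ := hinternal.exists_proj
    obtain ⟨x, hx⟩ := e.surjective (π a, MulOpposite.op (π b))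
    rw [he] at hx
    have h₁ : x - a ∈ J.map φ := by
      rw [← hker, map_sub, sub_eq_zero]
      exact congrArg Prod.fst hx
    have h₂ : x - φ b ∈ J := by
      have h : φ x - b ∈ J.map φ := by
        rw [← hker, map_sub, sub_eq_zero]
        exact congrArg (fun z => MulOpposite.unop (Prod.snd z)) hx
      obtain ⟨y, hy, hyx⟩ := h
      rwa [← hφ₂ x, ← map_sub, ← hyx, hφ₂]
    have h₁' := proj_mem_of_le_iSup_inf hP hP' hφJgr p h₁
    have h₂' := proj_mem_of_le_iSup_inf hP hP' hJgr p h₂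
    rw [map_sub, hP p a ha, ← hker, map_sub, sub_eq_zero] at h₁'
    rw [map_sub, hP p _ (hmemφ' p b hb)] at h₂'
    have h₃ := Submodule.mem_map_of_mem (f := φ) h₂'
    rw [map_sub, hφ₂, ← hker, map_sub, sub_eq_zero] at h₃
    refine ⟨P p x, hPmem p x, ?_⟩
    change e (P p x) = _
    rw [he, h₁', h₃]
    exact Prod.ext rfl hb'
end

section
/- Let G be a finitely generated abelian group and let A be a finite-dimensional simple associative algebra over a field F of characteristic different from 2, with a (ℤ×G)-grading Γ whose induced ℤ-grading has support {−1,0,1}. Then (A,Γ) is isomorphic as a graded algebra to M(G,D,γ₀,γ₁) for some (ℤ×G)-graded division algebra D, some γ₀ = (g₁,…,g_{k₀}) ∈ G^{k₀} and γ₁ = (g_{k₀+1},…,g_{k₀+k₁}) ∈ G^{k₁} with k₀, k₁ ≥ 1. Moreover, M(G,D,γ₀,γ₁) and M(G,D',γ'₀,γ'₁) are isomorphic as graded algebras if and only if D ≅ D' as graded algebras and there exists g ∈ G such that Ξ(γ_i) = gΞ(γ'_i) for i = 0,1. -/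
universe u v w

variable {F : Type u} [Field F] {G : Type v} [CommGroup G]

/-- `E.gr` is a (ℤ×G)-grading of the algebra `E.carrier`. -/
def IsGrading [DecidableEq G] (E : GrAlg.{u, v, w} F (ℤ × G)) : Prop :=
  DirectSum.IsInternal E.gr ∧ (1 : E.carrier) ∈ E.gr (0, 1) ∧
    ∀ p q : ℤ × G, ∀ x ∈ E.gr p, ∀ y ∈ E.gr q, x * y ∈ E.gr (p.1 + q.1, p.2 * q.2)

/-- `E` is a finite-dimensional (ℤ×G)-graded division algebra. -/
def IsGradedDivision [DecidableEq G] (E : GrAlg.{u, v, w} F (ℤ × G)) : Prop :=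
  IsGrading E ∧ FiniteDimensional F E.carrier ∧
    ∀ p : ℤ × G, ∀ x ∈ E.gr p, x ≠ 0 → IsUnit x

/-- The grading of the matrix algebra `M(G,D,γ₀,γ₁)`, on matrices indexed by
`Fin k₀ ⊕ Fin k₁` (δ = 0 on the first block, δ = 1 on the second):
`deg (d Eᵢⱼ) = (δᵢ − δⱼ + deg₁ d, γᵢ · deg₂ d · γⱼ⁻¹)`. -/
def matGr {D : Type w} [Ring D] [Algebra F D] (Dgr : ℤ × G → Submodule F D)
    {ι : Type*} (γ : ι → G) (δ : ι → ℤ) (p : ℤ × G) : Submodule F (Matrix ι ι D) where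
  carrier := {X | ∀ i j, X i j ∈ Dgr (p.1 - δ i + δ j, (γ i)⁻¹ * p.2 * γ j)}
  add_mem' := by
    intro X Y hX hY i j
    simpa [Matrix.add_apply] using add_mem (hX i j) (hY i j)
  zero_mem' := by
    intro i j
    simp only [Matrix.zero_apply]
    exact Submodule.zero_mem _
  smul_mem' := by
    intro c X hX i j
    simpa [Matrix.smul_apply] using Submodule.smul_mem _ c (hX i j)

/-- The δ-vector of `M(G,D,γ₀,γ₁)`: 0 on the first block, 1 on the second. -/
def delta01 (k₀ k₁ : ℕ) : Fin k₀ ⊕ Fin k₁ → ℤ := Sum.elim (fun _ => 0) fun _ => 1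

/-- `Ξ(γ)`: the multiset of the cosets modulo `T` of the entries of `γ`, translated by `g`. -/
def Xi (T : Subgroup G) (g : G) {k : ℕ} (γ : Fin k → G) : Multiset (G ⧸ T) :=
  (Finset.univ.val : Multiset (Fin k)).map fun i => ((g * γ i : G) : G ⧸ T)

namespace GradedSimple

section Existence

variable {H : Type*} [AddCommGroup H] [DecidableEq H] {A : Type*} [Ring A] [Algebra F A]

/-- In a simple algebra, `x * A * y ≠ 0` for nonzero `x` and `y`. -/
lemma exists_mul_mul_ne_zero
    (hA : ∀ K : Submodule F A, (∀ a : A, ∀ x ∈ K, a * x ∈ K ∧ x * a ∈ K) → K = ⊥ ∨ K = ⊤)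
    {x y : A} (hx : x ≠ 0) (hy : y ≠ 0) : ∃ a : A, x * a * y ≠ 0 := by
  by_contra! h
  let K : Submodule F A :=
    { carrier := {z | ∀ a : A, z * a * y = 0}
      add_mem' := fun {z w} hz hw a => by
        rw [add_mul, add_mul, hz a, hw a, add_zero]
      zero_mem' := fun a => by simp
      smul_mem' := fun c z hz a => by
        rw [smul_mul_assoc, smul_mul_assoc, hz a, smul_zero] }
  have hxK : x ∈ K := h
  rcases hA K fun a z hz => ⟨fun b => by rw [mul_assoc a, mul_assoc a, hz b, mul_zero],
    fun b => by rw [mul_assoc z, hz]⟩ with hK | hK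
  · exact hx (by simpa [hK] using hxK)
  · have h1 : (1 : A) ∈ K := hK ▸ Submodule.mem_top
    exact hy (by simpa using h1 1)

variable (𝒜 : H → Submodule F A) [GradedAlgebra 𝒜]

/-- In a graded simple algebra, `x * a * y ≠ 0` for a homogeneous `a`. -/
lemma exists_homogeneous_mul_mul_ne_zero
    (hA : ∀ K : Submodule F A, (∀ a : A, ∀ x ∈ K, a * x ∈ K ∧ x * a ∈ K) → K = ⊥ ∨ K = ⊤)
    {x y : A} (hx : x ≠ 0) (hy : y ≠ 0) : ∃ p, ∃ a ∈ 𝒜 p, x * a * y ≠ 0 := by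
  obtain ⟨a, ha⟩ := exists_mul_mul_ne_zero hA hx hy
  by_contra! h
  refine ha ?_
  induction a using DirectSum.Decomposition.inductionOn 𝒜 with
  | zero => simp
  | homogeneous a => exact h _ a a.2
  | add a b iha ihb =>
    by_cases h' : x * a * y = 0
    · by_cases h'' : x * b * y = 0
      · simp [mul_add, add_mul, h', h'']
      · exact absurd (ihb h'') h''
    · exact absurd (iha h') h'

/-- A homogeneous left multiple of a homogeneous element has a homogeneous cofactor. -/
lemma exists_homogeneous_left {p q : H} {x y a : A} (hx : x ∈ 𝒜 p) (hy : y ∈ 𝒜 q)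
    (h : a * x = y) : ∃ b ∈ 𝒜 (q - p), b * x = y := by
  refine ⟨DirectSum.decompose 𝒜 a (q - p), SetLike.coe_mem _, ?_⟩
  rw [← DirectSum.coe_decompose_mul_add_of_right_mem 𝒜 hx, h, sub_add_cancel,
    DirectSum.decompose_of_mem_same 𝒜 hy]

/-- A finite-dimensional graded simple algebra has a degree zero idempotent whose corner is a
graded division algebra. -/
lemma exists_division_idempotent [FiniteDimensional F A] [Nontrivial A]
    (hA : ∀ K : Submodule F A, (∀ a : A, ∀ x ∈ K, a * x ∈ K ∧ x * a ∈ K) → K = ⊥ ∨ K = ⊤) :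
    ∃ e ∈ 𝒜 0, e * e = e ∧ e ≠ 0 ∧ ∀ p, ∀ d ∈ 𝒜 p, e * d = d → d * e = d → d ≠ 0 →
      ∃ d' ∈ 𝒜 (-p), e * d' = d' ∧ d' * e = d' ∧ d' * d = e ∧ d * d' = e := by
  classical
  let r : A → ℕ := fun x => Module.finrank F (LinearMap.range (LinearMap.mulRight F x))
  have hex : ∃ n, ∃ p, ∃ x ∈ 𝒜 p, x ≠ 0 ∧ r x = n :=
    ⟨_, 0, 1, SetLike.GradedOne.one_mem, one_ne_zero, rfl⟩
  obtain ⟨p, x, hxp, hx0, hxr⟩ := Nat.find_spec hex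
  have hmin : ∀ q, ∀ a ∈ 𝒜 q, a * x ≠ 0 → ∀ b, ∃ c, c * (a * x) = b * x := by
    intro q a ha hax b
    have hle : LinearMap.range (LinearMap.mulRight F (a * x)) ≤
        LinearMap.range (LinearMap.mulRight F x) := by
      rintro _ ⟨c, rfl⟩
      exact ⟨c * a, by simp [mul_assoc]⟩
    have heq := Submodule.eq_of_le_of_finrank_le hle (by
      have := Nat.find_min' hex ⟨_, _, SetLike.GradedMul.mul_mem ha hxp, hax, rfl⟩
      rw [← hxr] at this
      exact this)
    have : b * x ∈ LinearMap.range (LinearMap.mulRight F (a * x)) := heq ▸ ⟨b, rfl⟩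
    exact this
  obtain ⟨q, a, ha, hxa⟩ := exists_homogeneous_mul_mul_ne_zero 𝒜 hA hx0 hx0
  have hax0 : a * x ≠ 0 := fun h => hxa (by rw [mul_assoc, h, mul_zero])
  have hax : a * x ∈ 𝒜 (q + p) := SetLike.GradedMul.mul_mem ha hxp
  have hxa' : x * a * x ∈ 𝒜 (p + q + p) :=
    SetLike.GradedMul.mul_mem (SetLike.GradedMul.mul_mem hxp ha) hxp
  -- right multiplication by `a * x` is injective on `A * x`
  have hinj : ∀ c, c * x * (a * x) = 0 → c * x = 0 := by
    let f : LinearMap.range (LinearMap.mulRight F x) →ₗ[F]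
        LinearMap.range (LinearMap.mulRight F x) :=
      (LinearMap.mulRight F (a * x)).restrict (by
        rintro _ ⟨c, rfl⟩
        exact ⟨c * x * a, by simp [mul_assoc]⟩)
    have hsurj : Function.Surjective f := by
      rintro ⟨_, b, rfl⟩
      obtain ⟨c, hc⟩ := hmin _ (x * a) (SetLike.GradedMul.mul_mem hxp ha) hxa b
      refine ⟨⟨c * x, c, rfl⟩, Subtype.ext ?_⟩
      simpa [f, mul_assoc] using hc
    have hf := LinearMap.injective_iff_surjective.2 hsurj
    intro c hc
    have : (⟨c * x, c, rfl⟩ : LinearMap.range (LinearMap.mulRight F x)) = 0 :=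
      hf (Subtype.ext (by simpa [f, mul_assoc] using hc))
    exact congrArg Subtype.val this
  obtain ⟨c, hc⟩ := hmin _ (x * a) (SetLike.GradedMul.mul_mem hxp ha) hxa a
  obtain ⟨c, hcp, hc⟩ := exists_homogeneous_left 𝒜 hxa' hax hc
  have hcx : c * x ∈ 𝒜 0 := by
    have := SetLike.GradedMul.mul_mem hcp hxp
    convert this using 2
    abel
  have hcx' : c * x * (a * x) = a * x := by simpa only [mul_assoc] using hc
  have hcx0 : c * x ≠ 0 := fun h => hax0 (by rw [← hcx', h, zero_mul])
  have hidem : c * x * (c * x) = c * x := by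
    have := hinj (c * x * c - c) (by
      rw [sub_mul, sub_mul, mul_assoc (c * x) c x, mul_assoc (c * x) (c * x), hcx', hcx',
        sub_self])
    rw [sub_mul, mul_assoc (c * x) c x] at this
    exact sub_eq_zero.1 this
  -- every nonzero homogeneous element of the corner has a homogeneous left inverse
  have hleft : ∀ r, ∀ d ∈ 𝒜 r, c * x * d = d → d * (c * x) = d → d ≠ 0 →
      ∃ d' ∈ 𝒜 (-r), c * x * d' = d' ∧ d' * (c * x) = d' ∧ d' * d = c * x := by
    intro r d hd hed hde hd0
    obtain ⟨y, hy⟩ := hmin _ (d * c) (SetLike.GradedMul.mul_mem hd hcp)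
      (by rwa [mul_assoc, hde]) c
    rw [mul_assoc d, hde] at hy
    obtain ⟨y, hyr, hy⟩ := exists_homogeneous_left 𝒜 hd hcx hy
    rw [zero_sub] at hyr
    refine ⟨c * x * y * (c * x), ?_, ?_, ?_, ?_⟩
    · have := SetLike.GradedMul.mul_mem (SetLike.GradedMul.mul_mem hcx hyr) hcx
      simpa using this
    · simp only [← mul_assoc]
      rw [mul_assoc (c * x) c x, hidem]
    · rw [mul_assoc _ (c * x), hidem]
    · rw [mul_assoc _ (c * x), hed, mul_assoc, hy, hidem]
  refine ⟨c * x, hcx, hidem, hcx0, fun r d hd hed hde hd0 => ?_⟩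
  obtain ⟨d', hd', hed', hde', h1⟩ := hleft r d hd hed hde hd0
  obtain ⟨d'', -, -, hde'', h2⟩ := hleft _ d' hd' hed' hde'
    (fun h => hcx0 (by rw [← h1, h, zero_mul]))
  refine ⟨d', hd', hed', hde', h1, ?_⟩
  have : d'' = d := by rw [← hde'', ← h1, ← mul_assoc, h2, hed]
  rw [← this, h2]

/-- In a finite-dimensional graded simple algebra, the identity decomposes along a system of
homogeneous matrix units based at a degree zero idempotent with graded division corner. -/
lemma exists_matrix_units [FiniteDimensional F A]
    (hA : ∀ K : Submodule F A, (∀ a : A, ∀ x ∈ K, a * x ∈ K ∧ x * a ∈ K) → K = ⊥ ∨ K = ⊤)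
    {e : A} (he : e ∈ 𝒜 0) (hee : e * e = e) (he0 : e ≠ 0)
    (hdiv : ∀ p, ∀ d ∈ 𝒜 p, e * d = d → d * e = d → d ≠ 0 →
      ∃ d' ∈ 𝒜 (-p), e * d' = d' ∧ d' * e = d' ∧ d' * d = e ∧ d * d' = e) :
    ∃ (n : ℕ) (h : Fin n → H) (u v : Fin n → A), (∀ i, u i ∈ 𝒜 (h i)) ∧
      (∀ i, v i ∈ 𝒜 (-h i)) ∧ (∀ i, u i * e = u i) ∧ (∀ i, e * v i = v i) ∧
      (∀ i j, v i * u j = if i = j then e else 0) ∧ ∑ i, u i * v i = 1 := by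
  classical
  let P : ℕ → Prop := fun n => ∃ (h : Fin n → H) (u v : Fin n → A), (∀ i, u i ∈ 𝒜 (h i)) ∧
      (∀ i, v i ∈ 𝒜 (-h i)) ∧ (∀ i, u i * e = u i) ∧ (∀ i, e * v i = v i) ∧
      (∀ i j, v i * u j = if i = j then e else 0)
  have hP0 : P 0 := ⟨Fin.elim0, Fin.elim0, Fin.elim0, by simp⟩
  have hbound : ∀ n, P n → n ≤ Module.finrank F A := by
    rintro n ⟨h, u, v, -, -, hu, -, hvu⟩
    have hli : LinearIndependent F u := by
      rw [Fintype.linearIndependent_iff]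
      intro g hg i
      have h1 := congrArg (v i * ·) hg
      simp only [Finset.mul_sum, mul_smul_comm, hvu, mul_zero, smul_ite, smul_zero,
        Finset.sum_ite_eq, Finset.mem_univ, if_true] at h1
      exact (smul_eq_zero.1 h1).resolve_right he0
    simpa using hli.fintype_card_le_finrank
  obtain ⟨n, hn, hmax⟩ : ∃ n, P n ∧ ¬ P (n + 1) := by
    by_contra! hcon
    have hall : ∀ n, P n := fun n => Nat.rec hP0 hcon n
    exact absurd (hbound _ (hall (Module.finrank F A + 1))) (by omega)
  obtain ⟨h, u, v, hu, hv, hue, hev, hvu⟩ := hn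
  refine ⟨n, h, u, v, hu, hv, hue, hev, hvu, ?_⟩
  by_contra hne
  set f : A := 1 - ∑ i, u i * v i with hf
  have hf0 : f ≠ 0 := sub_ne_zero.2 (Ne.symm hne)
  have hfdeg : f ∈ 𝒜 0 := by
    refine sub_mem SetLike.GradedOne.one_mem (sum_mem fun i _ => ?_)
    simpa using SetLike.GradedMul.mul_mem (hu i) (hv i)
  have hvf : ∀ i, v i * f = 0 := by
    intro i
    simp only [hf, mul_sub, mul_one, Finset.mul_sum, ← mul_assoc, hvu, ite_mul, zero_mul,
      Finset.sum_ite_eq, Finset.mem_univ, if_true, hev, sub_self]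
  have hfu : ∀ i, f * u i = 0 := by
    intro i
    simp only [hf, sub_mul, one_mul, Finset.sum_mul, mul_assoc, hvu, mul_ite, mul_zero,
      Finset.sum_ite_eq', Finset.mem_univ, if_true, hue, sub_self]
  have hff : f * f = f := by
    conv_lhs => rhs; rw [hf]
    simp only [mul_sub, mul_one, Finset.mul_sum, ← mul_assoc, hfu, zero_mul, Finset.sum_const_zero,
      sub_zero]
  obtain ⟨p, a, ha, ha0⟩ := exists_homogeneous_mul_mul_ne_zero 𝒜 hA he0 hf0
  obtain ⟨q, b, hb, hb0⟩ := exists_homogeneous_mul_mul_ne_zero 𝒜 hA ha0 he0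
  have hdmem : e * a * f * b * e ∈ 𝒜 (p + q) := by
    have := SetLike.GradedMul.mul_mem (SetLike.GradedMul.mul_mem
      (SetLike.GradedMul.mul_mem (SetLike.GradedMul.mul_mem he ha) hfdeg) hb) he
    simpa using this
  obtain ⟨d', hd', hed', hde', h1, -⟩ := hdiv _ _ hdmem
    (by simp only [← mul_assoc, hee]) (by rw [mul_assoc _ e e, hee]) hb0
  apply hmax
  refine ⟨Fin.cons q h, Fin.cons (f * b * e) u, Fin.cons (d' * e * a * f) v, ?_, ?_, ?_, ?_, ?_⟩
  · refine Fin.cases ?_ hu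
    have := SetLike.GradedMul.mul_mem (SetLike.GradedMul.mul_mem hfdeg hb) he
    simpa using this
  · refine Fin.cases ?_ hv
    have := SetLike.GradedMul.mul_mem (SetLike.GradedMul.mul_mem
      (SetLike.GradedMul.mul_mem hd' he) ha) hfdeg
    simp only [Fin.cons_zero]
    convert this using 2
    abel
  · refine Fin.cases ?_ hue
    simp only [Fin.cons_zero]
    rw [mul_assoc _ e e, hee]
  · refine Fin.cases ?_ hev
    simp only [Fin.cons_zero, ← mul_assoc, hed']
  · refine Fin.cases (Fin.cases ?_ fun j => ?_) fun i => Fin.cases ?_ fun j => ?_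
    · simp only [Fin.cons_zero, if_true]
      calc _ = d' * (e * a * (f * f) * b * e) := by simp only [mul_assoc]
        _ = e := by rw [hff, h1]
    · simp only [Fin.cons_zero, Fin.cons_succ, mul_assoc, hfu, mul_zero]
      rw [if_neg (Fin.succ_ne_zero j).symm]
    · simp only [Fin.cons_zero, Fin.cons_succ, ← mul_assoc, hvf, zero_mul]
      rw [if_neg (Fin.succ_ne_zero i)]
    · simp only [Fin.cons_succ, hvu, Fin.succ_inj]

end Existence

section Corner

variable {A : Type*} [Ring A] [Algebra F A] {e : A}

instance cornerModule (he : IsIdempotentElem e) : Module F he.Corner :=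
  letI : SMul F he.Corner := ⟨fun c x => ⟨c • x.1, by
    obtain ⟨a, ha⟩ := x.2
    exact ⟨c • a, by simp only [← ha, mul_smul_comm, smul_mul_assoc]⟩⟩⟩
  Function.Injective.module F (M₂ := he.Corner)
    { toFun := fun x => (x.1 : A), map_zero' := rfl, map_add' := fun _ _ => rfl }
    Subtype.val_injective fun _ _ => rfl

instance cornerAlgebra (he : IsIdempotentElem e) : Algebra F he.Corner :=
  Algebra.ofModule
    (fun c x y => Subtype.ext (smul_mul_assoc c x.1 y.1))
    (fun c x y => Subtype.ext (mul_smul_comm c x.1 y.1))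

variable (F) in
/-- The inclusion of the corner `e * A * e` into `A`. -/
def cornerVal (he : IsIdempotentElem e) : he.Corner →ₗ[F] A where
  toFun x := x.1
  map_add' _ _ := rfl
  map_smul' _ _ := rfl

lemma cornerVal_injective (he : IsIdempotentElem e) : Function.Injective (cornerVal F he) :=
  Subtype.val_injective

lemma cornerVal_one (he : IsIdempotentElem e) : cornerVal F he 1 = e := rfl

lemma mul_cornerVal (he : IsIdempotentElem e) (x : he.Corner) :
    e * cornerVal F he x = cornerVal F he x :=
  ((Subsemigroup.mem_corner_iff he).1 x.2).1

lemma cornerVal_mul_self (he : IsIdempotentElem e) (x : he.Corner) :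
    cornerVal F he x * e = cornerVal F he x :=
  ((Subsemigroup.mem_corner_iff he).1 x.2).2

/-- An element of `A` fixed by `e` on both sides, as an element of the corner. -/
def cornerMk (he : IsIdempotentElem e) (a : A) (h₁ : e * a = a) (h₂ : a * e = a) : he.Corner :=
  ⟨a, (Subsemigroup.mem_corner_iff he).2 ⟨h₁, h₂⟩⟩

lemma cornerVal_cornerMk (he : IsIdempotentElem e) (a : A) (h₁ : e * a = a) (h₂ : a * e = a) :
    cornerVal F he (cornerMk he a h₁ h₂) = a := rfl

variable {H : Type*} (𝒜 : H → Submodule F A)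

/-- The grading induced on a corner. -/
def cornerGr (he : IsIdempotentElem e) (p : H) : Submodule F he.Corner :=
  (𝒜 p).comap (cornerVal F he)

lemma mem_cornerGr (he : IsIdempotentElem e) {p : H} {x : he.Corner} :
    x ∈ cornerGr 𝒜 he p ↔ cornerVal F he x ∈ 𝒜 p := Iff.rfl

variable [AddCommGroup H] [DecidableEq H] [GradedAlgebra 𝒜]

lemma cornerGr_isInternal (he : IsIdempotentElem e) (he0 : e ∈ 𝒜 0) :
    DirectSum.IsInternal (cornerGr 𝒜 he) := by
  classical
  rw [DirectSum.isInternal_submodule_iff_iSupIndep_and_iSup_eq_top]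
  constructor
  · intro p
    have hind := (DirectSum.Decomposition.isInternal 𝒜).submodule_iSupIndep p
    rw [Submodule.disjoint_def] at hind ⊢
    intro x hx hx'
    refine cornerVal_injective he ((hind _ hx ?_).trans (map_zero (cornerVal F he)).symm)
    have := Submodule.mem_map_of_mem (f := cornerVal F he) hx'
    simp only [Submodule.map_iSup] at this
    exact iSup₂_mono (fun q _ => Submodule.map_comap_le (cornerVal F he) (𝒜 q)) this
  · rw [eq_top_iff]
    intro x _
    have hcomp : ∀ p, e * (DirectSum.decompose 𝒜 (cornerVal F he x) p : A) =
        DirectSum.decompose 𝒜 (cornerVal F he x) p := fun p => by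
      have := DirectSum.coe_decompose_mul_add_of_left_mem 𝒜 (j := p) (b := cornerVal F he x) he0
      rw [mul_cornerVal, zero_add] at this
      exact this.symm
    have hcomp' : ∀ p, (DirectSum.decompose 𝒜 (cornerVal F he x) p : A) * e =
        DirectSum.decompose 𝒜 (cornerVal F he x) p := fun p => by
      have := DirectSum.coe_decompose_mul_add_of_right_mem 𝒜 (i := p) (a := cornerVal F he x) he0
      rw [cornerVal_mul_self, add_zero] at this
      exact this.symm
    have hx : x = ∑ p ∈ (DirectSum.decompose 𝒜 (cornerVal F he x)).support,
        cornerMk he _ (hcomp p) (hcomp' p) := by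
      apply cornerVal_injective (F := F) he
      rw [map_sum]
      exact (DirectSum.sum_support_decompose 𝒜 (cornerVal F he x)).symm
    rw [hx]
    refine sum_mem fun p _ => Submodule.mem_iSup_of_mem p ?_
    rw [mem_cornerGr, cornerVal_cornerMk]
    exact SetLike.coe_mem _

variable {ι : Type*} [Fintype ι] [DecidableEq ι]

/-- The isomorphism of `A` with a matrix algebra over a corner given by a system of matrix
units. -/
def matrixEquivCorner (he : IsIdempotentElem e) (u v : ι → A) (hu : ∀ i, u i * e = u i)
    (hv : ∀ i, e * v i = v i) (hvu : ∀ i j, v i * u j = if i = j then e else 0)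
    (huv : ∑ i, u i * v i = 1) : A ≃ₐ[F] Matrix ι ι he.Corner where
  toFun a := Matrix.of fun i j => cornerMk he (v i * a * u j)
    (by rw [← mul_assoc, ← mul_assoc, hv]) (by rw [mul_assoc _ (u j), hu])
  invFun X := ∑ i, ∑ j, u i * cornerVal F he (X i j) * v j
  left_inv a := by
    calc ∑ i, ∑ j, u i * (v i * a * u j) * v j
        = (∑ i, u i * v i) * a * ∑ j, u j * v j := by
          simp only [Finset.sum_mul, Finset.mul_sum, mul_assoc]
          rw [Finset.sum_comm]
      _ = a := by rw [huv, one_mul, mul_one]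
  right_inv X := by
    ext i j
    apply cornerVal_injective (F := F) he
    change v i * (∑ k, ∑ l, u k * cornerVal F he (X k l) * v l) * u j = _
    simp only [Finset.sum_mul, Finset.mul_sum]
    have : ∀ k l, v i * (u k * cornerVal F he (X k l) * v l) * u j =
        if l = j then (if i = k then cornerVal F he (X k l) else 0) else 0 := fun k l => by
      calc _ = (v i * u k) * cornerVal F he (X k l) * (v l * u j) := by simp only [mul_assoc]
        _ = _ := by
          rw [hvu, hvu]
          split_ifs <;> simp [mul_cornerVal, cornerVal_mul_self]
    simp only [this, Finset.sum_ite_eq', Finset.sum_ite_eq, Finset.mem_univ, if_true]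
  map_mul' a b := by
    ext i j
    apply cornerVal_injective (F := F) he
    rw [Matrix.mul_apply, map_sum]
    change v i * (a * b) * u j = ∑ k, (v i * a * u k) * (v k * b * u j)
    calc v i * (a * b) * u j = v i * a * (∑ k, u k * v k) * (b * u j) := by
          rw [huv]; simp only [mul_assoc, one_mul]
      _ = _ := by simp only [Finset.sum_mul, Finset.mul_sum, mul_assoc]
  map_add' a b := by
    ext i j
    apply cornerVal_injective (F := F) he
    change v i * (a + b) * u j = v i * a * u j + v i * b * u j
    rw [mul_add, add_mul]
  commutes' c := by
    ext i j
    apply cornerVal_injective (F := F) he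
    rw [Algebra.algebraMap_eq_smul_one, Algebra.algebraMap_eq_smul_one, Matrix.smul_apply,
      map_smul, Matrix.one_apply]
    change v i * (c • 1) * u j = _
    rw [mul_smul_comm, mul_one, smul_mul_assoc, hvu]
    split_ifs <;> simp [cornerVal_one]

lemma cornerVal_matrixEquivCorner (he : IsIdempotentElem e) (u v : ι → A)
    (hu : ∀ i, u i * e = u i) (hv : ∀ i, e * v i = v i)
    (hvu : ∀ i j, v i * u j = if i = j then e else 0) (huv : ∑ i, u i * v i = 1)
    (a : A) (i j : ι) :
    cornerVal F he (matrixEquivCorner (F := F) he u v hu hv hvu huv a i j) = v i * a * u j := rfl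

lemma mem_iff_matrixEquivCorner (he : IsIdempotentElem e) {h : ι → H} (u v : ι → A)
    (hu : ∀ i, u i * e = u i) (hv : ∀ i, e * v i = v i)
    (hvu : ∀ i j, v i * u j = if i = j then e else 0) (huv : ∑ i, u i * v i = 1)
    (hdu : ∀ i, u i ∈ 𝒜 (h i)) (hdv : ∀ i, v i ∈ 𝒜 (-h i)) (a : A) (p : H) :
    a ∈ 𝒜 p ↔ ∀ i j, matrixEquivCorner (F := F) he u v hu hv hvu huv a i j ∈
      cornerGr 𝒜 he (p - h i + h j) := by
  simp only [mem_cornerGr, cornerVal_matrixEquivCorner]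
  constructor
  · intro ha i j
    have := SetLike.GradedMul.mul_mem (SetLike.GradedMul.mul_mem (hdv i) ha) (hdu j)
    convert this using 2
    abel
  · intro ha
    rw [← (matrixEquivCorner (F := F) he u v hu hv hvu huv).symm_apply_apply a]
    refine sum_mem fun i _ => sum_mem fun j _ => ?_
    have := SetLike.GradedMul.mul_mem (SetLike.GradedMul.mul_mem (hdu i) (ha i j)) (hdv j)
    rwa [show h i + (p - h i + h j) + -h j = p by abel] at this

end Corner

lemma map_eq_of_mem_iff {A B : Type*} [Ring A] [Algebra F A] [Ring B] [Algebra F B]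
    (e : A ≃ₐ[F] B) {S : Submodule F A} {S' : Submodule F B} (h : ∀ x, x ∈ S ↔ e x ∈ S') :
    Submodule.map (e : A →ₗ[F] B) S = S' := by
  ext y
  constructor
  · rintro ⟨x, hx, rfl⟩
    exact (h x).1 hx
  · intro hy
    exact ⟨e.symm y, (h _).2 (by simpa using hy), by simp⟩

lemma mem_iff_of_map_eq {A B : Type*} [Ring A] [Algebra F A] [Ring B] [Algebra F B]
    (e : A ≃ₐ[F] B) {S : Submodule F A} {S' : Submodule F B}
    (h : Submodule.map (e : A →ₗ[F] B) S = S') (x : A) : x ∈ S ↔ e x ∈ S' := by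
  rw [← h]
  constructor
  · exact fun hx => ⟨x, hx, rfl⟩
  · rintro ⟨y, hy, hyx⟩
    rwa [← e.injective hyx]

/-- A grading by `ℤ × G`, the second factor written additively. -/
abbrev additiveGr {K A : Type*} [Ring A] [Algebra F A] (Γ : ℤ × K → Submodule F A) :
    ℤ × Additive K → Submodule F A := fun p => Γ (p.1, p.2.toMul)

lemma isInternal_additiveGr {K A : Type*} [DecidableEq K] [Ring A] [Algebra F A]
    {Γ : ℤ × K → Submodule F A} :
    DirectSum.IsInternal (additiveGr Γ) ↔ DirectSum.IsInternal Γ := by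
  rw [DirectSum.isInternal_submodule_iff_iSupIndep_and_iSup_eq_top,
    DirectSum.isInternal_submodule_iff_iSupIndep_and_iSup_eq_top]
  exact Iff.rfl

lemma mem_matGr_iff {D : Type w} [Ring D] [Algebra F D] (Dgr : ℤ × G → Submodule F D)
    {ι : Type*} (γ : ι → G) (δ : ι → ℤ) (p : ℤ × Additive G) (X : Matrix ι ι D) :
    X ∈ matGr Dgr γ δ (p.1, p.2.toMul) ↔
      ∀ i j, X i j ∈ additiveGr Dgr (p - (δ i, .ofMul (γ i)) + (δ j, .ofMul (γ j))) := by
  refine forall₂_congr fun i j => ?_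
  have : (γ i)⁻¹ * p.2.toMul = p.2.toMul / γ i := by rw [mul_comm, div_eq_mul_inv]
  change X i j ∈ Dgr (_, (γ i)⁻¹ * p.2.toMul * γ j) ↔ X i j ∈ Dgr (_, p.2.toMul / γ i * γ j)
  rw [this]
  rfl

theorem exists_matrix_model [DecidableEq G] (A : Type w) [Ring A] [Algebra F A]
    [FiniteDimensional F A] [Nontrivial A]
    (hA : ∀ K : Submodule F A, (∀ a : A, ∀ x ∈ K, a * x ∈ K ∧ x * a ∈ K) → K = ⊥ ∨ K = ⊤)
    (Γ : ℤ × G → Submodule F A) (hinternal : DirectSum.IsInternal Γ) (hone : (1 : A) ∈ Γ (0, 1))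
    (hmul : ∀ p q : ℤ × G, ∀ x ∈ Γ p, ∀ y ∈ Γ q, x * y ∈ Γ (p.1 + q.1, p.2 * q.2))
    (hsupp : ∀ p : ℤ × G, Γ p ≠ ⊥ → p.1 = -1 ∨ p.1 = 0 ∨ p.1 = 1)
    (hsupp₁ : ∃ g : G, Γ (1, g) ≠ ⊥) :
    ∃ (D : GrAlg.{u, v, w} F (ℤ × G)) (k₀ k₁ : ℕ) (γ₀ : Fin k₀ → G) (γ₁ : Fin k₁ → G),
      IsGradedDivision D ∧ 1 ≤ k₀ ∧ 1 ≤ k₁ ∧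
      ∃ e : A ≃ₐ[F] Matrix (Fin k₀ ⊕ Fin k₁) (Fin k₀ ⊕ Fin k₁) D.carrier,
        ∀ p : ℤ × G,
          Submodule.map (e : A →ₗ[F] Matrix (Fin k₀ ⊕ Fin k₁) (Fin k₀ ⊕ Fin k₁) D.carrier)
              (Γ p)
            = matGr D.gr (Sum.elim γ₀ γ₁) (delta01 k₀ k₁) p := by
  classical
  let _ : GradedAlgebra (additiveGr Γ) :=
    { one_mem := hone
      mul_mem := fun {p q} x y hx hy => hmul _ _ x hx y hy
      toDecomposition := DirectSum.IsInternal.chooseDecomposition (additiveGr Γ)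
        (isInternal_additiveGr.2 hinternal) }
  have hsupp' : ∀ p : ℤ × Additive G, ∀ x ∈ additiveGr Γ p, x ≠ 0 →
      p.1 = -1 ∨ p.1 = 0 ∨ p.1 = 1 := fun p x hx hx0 =>
    hsupp _ fun hbot => hx0 ((Submodule.mem_bot F).1 (hbot ▸ hx))
  obtain ⟨e, hedeg, hee, he0, hdiv⟩ := exists_division_idempotent (additiveGr Γ) hA
  obtain ⟨n, h, u, v, hdu, hdv, hu, hv, hvu, huv⟩ :=
    exists_matrix_units (additiveGr Γ) hA hedeg hee he0 hdiv
  have he : IsIdempotentElem e := hee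
  have hdiv0 : ∀ p, ∀ d ∈ additiveGr Γ p, e * d = d → d * e = d → d ≠ 0 → p.1 = 0 := by
    intro p d hd hed hde hd0
    obtain ⟨d', -, -, -, h1, -⟩ := hdiv p d hd hed hde hd0
    have hdd : d * d ≠ 0 := fun h => hd0 (by rw [← hed, ← h1, mul_assoc, h, mul_zero])
    have h2 := hsupp' _ _ (SetLike.GradedMul.mul_mem hd hd) hdd
    rw [Prod.fst_add] at h2
    omega
  have hdiff : ∀ i j, (h i).1 - (h j).1 = -1 ∨ (h i).1 - (h j).1 = 0 ∨ (h i).1 - (h j).1 = 1 := by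
    intro i j
    have hne : u i * v j ≠ 0 := fun h => he0 (by
      calc e = v i * u i * (v j * u j) := by simp [hvu, hee]
        _ = v i * (u i * v j) * u j := by simp only [mul_assoc]
        _ = 0 := by rw [h]; simp)
    have := hsupp' _ _ (SetLike.GradedMul.mul_mem (hdu i) (hdv j)) hne
    simpa [sub_eq_add_neg] using this
  obtain ⟨i₁, j₁, hij⟩ : ∃ i j, (h i).1 - (h j).1 = 1 := by
    obtain ⟨g, hg⟩ := hsupp₁
    obtain ⟨a, ha, ha0⟩ := Submodule.exists_mem_ne_zero_of_ne_bot hg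
    by_contra! hcon
    refine ha0 ((matrixEquivCorner (F := F) he u v hu hv hvu huv).injective ?_)
    rw [map_zero]
    ext i j
    apply cornerVal_injective (F := F) he
    by_contra hne
    have hmem := (mem_iff_matrixEquivCorner (additiveGr Γ) he u v hu hv hvu huv hdu hdv a
      ((1, .ofMul g) : ℤ × Additive G)).1 ha i j
    have := hdiv0 _ _ hmem (mul_cornerVal he _) (cornerVal_mul_self he _) hne
    simp only [Prod.fst_add, Prod.fst_sub] at this
    exact hcon i j (by omega)
  let m := (h j₁).1
  have hm : ∀ k, (h k).1 = m ∨ (h k).1 = m + 1 := fun k => by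
    have h1 := hdiff k i₁
    have h2 := hdiff k j₁
    have h3 : (h i₁).1 - m = 1 := hij
    change _ - m = _ ∨ _ - m = _ ∨ _ - m = _ at h2
    omega
  let κ₀ := {k // (h k).1 = m}
  let κ₁ := {k // ¬ (h k).1 = m}
  let σ : Fin (Fintype.card κ₀) ⊕ Fin (Fintype.card κ₁) ≃ Fin n :=
    (Equiv.sumCongr (Fintype.equivFin κ₀).symm (Fintype.equivFin κ₁).symm).trans
      (Equiv.sumCompl _)
  let γ₀ : Fin (Fintype.card κ₀) → G := fun k => (h (σ (.inl k))).2.toMul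
  let γ₁ : Fin (Fintype.card κ₁) → G := fun k => (h (σ (.inr k))).2.toMul
  have hσ : ∀ k, h (σ k) = (delta01 _ _ k, .ofMul (Sum.elim γ₀ γ₁ k)) + (m, 0) := by
    rintro (k | k)
    · refine Prod.ext ?_ (by simp [γ₀])
      have : (h (σ (.inl k))).1 = m := ((Fintype.equivFin κ₀).symm k).2
      simpa [delta01] using this
    · refine Prod.ext ?_ (by simp [γ₁])
      have h1 : ¬ (h (σ (.inr k))).1 = m := ((Fintype.equivFin κ₁).symm k).2
      have h2 := (hm (σ (.inr k))).resolve_left h1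
      simp only [delta01, Prod.fst_add, Sum.elim_inr]
      omega
  have hvu' : ∀ i j, (v ∘ σ) i * (u ∘ σ) j = if i = j then e else 0 := fun i j => by
    simp only [Function.comp_apply, hvu, σ.injective.eq_iff]
  have huv' : ∑ i, (u ∘ σ) i * (v ∘ σ) i = 1 := by
    rw [← huv]
    exact Equiv.sum_comp σ fun i => u i * v i
  refine ⟨⟨he.Corner, fun p => cornerGr (additiveGr Γ) he (p.1, .ofMul p.2)⟩, Fintype.card κ₀,
    Fintype.card κ₁, γ₀, γ₁, ⟨⟨?_, hedeg, ?_⟩, ?_, ?_⟩, ?_, ?_,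
    matrixEquivCorner he (u ∘ σ) (v ∘ σ) (fun _ => hu _) (fun _ => hv _) hvu' huv', ?_⟩
  · exact isInternal_additiveGr.1 (cornerGr_isInternal (additiveGr Γ) he hedeg)
  · intro p q x hx y hy
    exact hmul _ _ _ hx _ hy
  · exact FiniteDimensional.of_injective (cornerVal F he) (cornerVal_injective he)
  · intro p x hx hx0
    obtain ⟨d, -, hed, hde, h1, h2⟩ := hdiv _ (cornerVal F he x) hx (mul_cornerVal he x)
      (cornerVal_mul_self he x) fun h => hx0 (cornerVal_injective he h)
    exact ⟨⟨x, cornerMk he d hed hde, Subtype.ext h2, Subtype.ext h1⟩, rfl⟩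
  · exact Fintype.card_pos_iff.2 ⟨⟨j₁, rfl⟩⟩
  · exact Fintype.card_pos_iff.2 ⟨⟨i₁, fun h' => by
      have h3 : (h i₁).1 - m = 1 := hij
      omega⟩⟩
  · intro p
    refine map_eq_of_mem_iff _ fun x => ?_
    refine (mem_iff_matrixEquivCorner (additiveGr Γ) he (u ∘ σ) (v ∘ σ) (fun _ => hu _)
      (fun _ => hv _) hvu' huv' (fun _ => hdu _) (fun _ => hdv _) x (p.1, .ofMul p.2)).trans ?_
    refine Iff.trans ?_ (mem_matGr_iff _ _ _ (p.1, .ofMul p.2) _).symm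
    refine forall₂_congr fun i j => ?_
    refine iff_of_eq (congrArg (fun q => _ ∈ cornerGr (additiveGr Γ) he q) ?_)
    rw [hσ, hσ]
    exact (show ∀ a b c d : ℤ × Additive G, a - (b + d) + (c + d) = a - b + c from
      fun a b c d => by abel) _ _ _ _

section Matrix

variable {H : Type*} [AddCommGroup H] {D D' : Type*} [Ring D] [Algebra F D] [Ring D']
  [Algebra F D'] {𝒟 : H → Submodule F D} {𝒟' : H → Submodule F D'}

variable (𝒟) in
/-- A multiplicative family of subspaces whose nonzero elements have inverses of opposite
degree. -/
structure IsDivisionFamily : Prop where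
  one_mem : 1 ∈ 𝒟 0
  mul_mem : ∀ {p q x y}, x ∈ 𝒟 p → y ∈ 𝒟 q → x * y ∈ 𝒟 (p + q)
  exists_inv : ∀ {p x}, x ∈ 𝒟 p → x ≠ 0 → ∃ y ∈ 𝒟 (-p), x * y = 1 ∧ y * x = 1

variable {ι ι' : Type*}

variable (𝒟) in
/-- Homogeneous matrices of degree `p`, the rows and columns having degrees `h`. -/
def IsHomogeneousMatrix (h : ι → H) (p : H) (X : Matrix ι ι D) : Prop :=
  ∀ i j, X i j ∈ 𝒟 (p - h i + h j)

lemma IsHomogeneousMatrix.single [DecidableEq ι] {h : ι → H} {p : H} {i j : ι} {a : D}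
    (ha : a ∈ 𝒟 (p - h i + h j)) : IsHomogeneousMatrix 𝒟 h p (Matrix.single i j a) := by
  intro k l
  rw [Matrix.single_apply]
  split_ifs with hkl
  · rwa [← hkl.1, ← hkl.2]
  · exact zero_mem _

lemma IsHomogeneousMatrix.mul [Fintype ι] (h𝒟 : IsDivisionFamily 𝒟) {h : ι → H} {p q : H}
    {X Y : Matrix ι ι D} (hX : IsHomogeneousMatrix 𝒟 h p X) (hY : IsHomogeneousMatrix 𝒟 h q Y) :
    IsHomogeneousMatrix 𝒟 h (p + q) (X * Y) := by
  intro i j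
  rw [Matrix.mul_apply]
  refine sum_mem fun k _ => ?_
  have := h𝒟.mul_mem (hX i k) (hY k j)
  rwa [show p - h i + h k + (q - h k + h j) = p + q - h i + h j by abel] at this

variable [Fintype ι] [DecidableEq ι] [Fintype ι'] [DecidableEq ι']

lemma single_mul_mul_single_eq {κ R : Type*} [Fintype κ] [DecidableEq κ] [Ring R] {j : κ}
    {X : Matrix κ κ R} (h₁ : .single j j 1 * X = X) (h₂ : X * .single j j 1 = X) :
    Matrix.single j j (X j j) = X := by
  conv_rhs => rw [← h₂, ← h₁, Matrix.single_mul_mul_single, one_mul, mul_one]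

/-- A graded isomorphism of matrix algebras sends a diagonal matrix unit to an idempotent
equivalent to a diagonal matrix unit. -/
lemma exists_equiv_diagonal [Nontrivial D] (h𝒟 : IsDivisionFamily 𝒟)
    (h𝒟' : IsDivisionFamily 𝒟') {h : ι → H} {h' : ι' → H}
    (e : Matrix ι ι D ≃ₐ[F] Matrix ι' ι' D')
    (he : ∀ p X, IsHomogeneousMatrix 𝒟 h p X ↔ IsHomogeneousMatrix 𝒟' h' p (e X)) (i₀ : ι) :
    ∃ (j : ι') (u v : Matrix ι' ι' D'), IsHomogeneousMatrix 𝒟' h' 0 u ∧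
      IsHomogeneousMatrix 𝒟' h' 0 v ∧ u * v = e (.single i₀ i₀ 1) ∧ v * u = .single j j 1 ∧
      u * .single j j 1 = u ∧ .single j j 1 * v = v := by
  set w := e (.single i₀ i₀ 1) with hw
  have hww : w * w = w := by rw [hw, ← map_mul, Matrix.single_mul_single_same, one_mul]
  have hwdeg : IsHomogeneousMatrix 𝒟' h' 0 w := (he _ _).1 (.single (by simpa using h𝒟.one_mem))
  have hw0 : w ≠ 0 := fun h => one_ne_zero (α := D) (by
    have h1 := congrFun (congrFun ((map_eq_zero_iff e e.injective).1 h) i₀) i₀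
    simp at h1)
  obtain ⟨i, j, hij⟩ : ∃ i j, w i j ≠ 0 := by
    by_contra! hcon
    exact hw0 (Matrix.ext hcon)
  obtain ⟨y, -, -, hy⟩ := h𝒟'.exists_inv (hwdeg i j) hij
  have hunit : w * .single j i 1 * w ≠ 0 := fun h => hij (by
    have h1 : w i j * w i j = 0 := by
      have h2 := congrFun (congrFun h i) j
      rw [Matrix.mul_assoc, Matrix.mul_apply, Finset.sum_eq_single j] at h2
      · simpa using h2
      · intro k _ hk
        rw [Matrix.single_mul_apply_of_ne _ _ _ _ _ hk, mul_zero]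
      · simp
    rw [← one_mul (w i j), ← hy, mul_assoc, h1, mul_zero])
  set Y := e.symm (.single j i 1) with hY
  have hYdeg : IsHomogeneousMatrix 𝒟 h (h' j - h' i) Y := by
    rw [he, hY, AlgEquiv.apply_symm_apply]
    exact .single (by
      rw [show h' j - h' i - h' j + h' i = 0 by abel]
      exact h𝒟'.one_mem)
  have hwYw : w * .single j i 1 * w = e (.single i₀ i₀ (Y i₀ i₀)) := by
    rw [← e.apply_symm_apply (.single j i 1), ← hY, hw, ← map_mul, ← map_mul,
      Matrix.single_mul_mul_single, one_mul, mul_one]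
  have hY0 : Y i₀ i₀ ≠ 0 := fun h => hunit (by rw [hwYw, h, Matrix.single_zero, map_zero])
  obtain ⟨c, hc, hc1, -⟩ := h𝒟.exists_inv (hYdeg i₀ i₀) hY0
  set z := e (.single i₀ i₀ c) with hz
  have hzdeg : IsHomogeneousMatrix 𝒟' h' (h' i - h' j) z := by
    refine (he _ _).1 (.single ?_)
    rwa [show h' i - h' j - h i₀ + h i₀ = -(h' j - h' i - h i₀ + h i₀) by abel]
  have huv : w * .single j i 1 * w * z = w := by
    rw [hwYw, hz, ← map_mul, Matrix.single_mul_single_same, hc1]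
  obtain ⟨u, hu⟩ : ∃ u : Matrix ι' ι' D', u = w * .single j j 1 := ⟨_, rfl⟩
  obtain ⟨v, hv⟩ : ∃ v : Matrix ι' ι' D', v = .single j i 1 * w * z := ⟨_, rfl⟩
  have hu_deg : IsHomogeneousMatrix 𝒟' h' 0 u := by
    have := hwdeg.mul h𝒟' (.single (i := j) (j := j) (p := 0) (by simpa using h𝒟'.one_mem))
    rwa [zero_add, ← hu] at this
  have hv_deg : IsHomogeneousMatrix 𝒟' h' 0 v := by
    have h1 : IsHomogeneousMatrix 𝒟' h' (h' j - h' i) (.single j i 1) := .single (by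
      rw [show h' j - h' i - h' j + h' i = 0 by abel]
      exact h𝒟'.one_mem)
    have := (h1.mul h𝒟' hwdeg).mul h𝒟' hzdeg
    rwa [show h' j - h' i + 0 + (h' i - h' j) = 0 by abel, ← hv] at this
  have huv' : u * v = w := by
    rw [hu, hv, ← Matrix.mul_assoc, ← Matrix.mul_assoc, Matrix.mul_assoc w,
      Matrix.single_mul_single_same, one_mul, huv]
  have hwu : w * u = u := by rw [hu, ← Matrix.mul_assoc, hww]
  have hsv : .single j j 1 * v = v := by
    rw [hv, ← Matrix.mul_assoc, ← Matrix.mul_assoc, Matrix.single_mul_single_same, one_mul]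
  have hus : u * .single j j 1 = u := by
    rw [hu, Matrix.mul_assoc, Matrix.single_mul_single_same, one_mul]
  have hvu : .single j j ((v * u) j j) = v * u := single_mul_mul_single_eq
    (by rw [← Matrix.mul_assoc, hsv]) (by rw [Matrix.mul_assoc, hus])
  refine ⟨j, u, v, hu_deg, hv_deg, huv', ?_, hus, hsv⟩
  have hidem : v * u * (v * u) = v * u := by
    rw [Matrix.mul_assoc, ← Matrix.mul_assoc u, huv', hwu]
  have hmem := (hv_deg.mul h𝒟' hu_deg) j j
  have hne : (v * u) j j ≠ 0 := fun h => hw0 (by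
    rw [h, Matrix.single_zero] at hvu
    rw [← hww, ← huv', Matrix.mul_assoc, ← Matrix.mul_assoc v, ← hvu, Matrix.zero_mul,
      Matrix.mul_zero])
  obtain ⟨b, -, -, hb⟩ := h𝒟'.exists_inv hmem hne
  have hone : (v * u) j j = 1 := by
    have h1 : (v * u) j j * (v * u) j j = (v * u) j j := by
      have h2 := congrFun (congrFun hidem j) j
      rw [← hvu] at h2
      simpa using h2
    calc (v * u) j j = b * (v * u) j j * (v * u) j j := by rw [hb, one_mul]
      _ = 1 := by rw [mul_assoc, h1, hb]
  rw [← hvu, hone]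

section Linked

variable {h : ι → H} {h' : ι' → H} (e : Matrix ι ι D ≃ₐ[F] Matrix ι' ι' D') {i₀ : ι} {j₀ : ι'}
  {u v : Matrix ι' ι' D'}

lemma single_apply_conj (hu : u * .single j₀ j₀ 1 = u) (hv : .single j₀ j₀ 1 * v = v) (a : D) :
    Matrix.single j₀ j₀ ((v * e (.single i₀ i₀ a) * u) j₀ j₀) = v * e (.single i₀ i₀ a) * u :=
  single_mul_mul_single_eq (by rw [← Matrix.mul_assoc, ← Matrix.mul_assoc, hv])
    (by rw [Matrix.mul_assoc, hu])

lemma conj_mul_conj (huv : u * v = e (.single i₀ i₀ 1)) (a b : D) :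
    v * e (.single i₀ i₀ (a * b)) * u =
      v * e (.single i₀ i₀ a) * u * (v * e (.single i₀ i₀ b) * u) := by
  have h1 : e (.single i₀ i₀ (a * b)) =
      e (.single i₀ i₀ a) * (u * v) * e (.single i₀ i₀ b) := by
    rw [huv, ← map_mul, ← map_mul, Matrix.single_mul_single_same, Matrix.single_mul_single_same,
      mul_one]
  rw [h1]
  simp only [Matrix.mul_assoc]

lemma mul_conj_mul (huv : u * v = e (.single i₀ i₀ 1)) (a : D) :
    u * (v * e (.single i₀ i₀ a) * u) * v = e (.single i₀ i₀ a) := by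
  have h1 : u * (v * e (.single i₀ i₀ a) * u) * v = u * v * e (.single i₀ i₀ a) * (u * v) := by
    simp only [Matrix.mul_assoc]
  rw [h1, huv, ← map_mul, ← map_mul, Matrix.single_mul_single_same,
    Matrix.single_mul_single_same, one_mul, mul_one]

lemma single_symm_apply (huv : u * v = e (.single i₀ i₀ 1)) (hvu : v * u = .single j₀ j₀ 1)
    (hu : u * .single j₀ j₀ 1 = u) (hv : .single j₀ j₀ 1 * v = v) (b : D') :
    Matrix.single i₀ i₀ (e.symm (u * .single j₀ j₀ b * v) i₀ i₀) =
      e.symm (u * .single j₀ j₀ b * v) := by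
  refine single_mul_mul_single_eq (e.injective ?_) (e.injective ?_)
  · rw [map_mul, AlgEquiv.apply_symm_apply, ← huv, ← Matrix.mul_assoc, ← Matrix.mul_assoc,
      Matrix.mul_assoc u v u, hvu, hu]
  · rw [map_mul, AlgEquiv.apply_symm_apply, ← huv, Matrix.mul_assoc, ← Matrix.mul_assoc v,
      hvu, hv]

lemma mul_single_mul (hvu : v * u = .single j₀ j₀ 1) (b : D') :
    v * (u * .single j₀ j₀ b * v) * u = .single j₀ j₀ b := by
  have h1 : v * (u * .single j₀ j₀ b * v) * u = v * u * .single j₀ j₀ b * (v * u) := by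
    simp only [Matrix.mul_assoc]
  rw [h1, hvu, Matrix.single_mul_single_same, Matrix.single_mul_single_same, one_mul, mul_one]

variable (i₀ j₀ u v) in
/-- The linear map underlying `coeffEquiv`. -/
def coeffMap : D →ₗ[F] D' where
  toFun a := (v * e (.single i₀ i₀ a) * u) j₀ j₀
  map_add' a b := by
    rw [Matrix.single_add, map_add, Matrix.mul_add, Matrix.add_mul, Matrix.add_apply]
  map_smul' c a := by
    rw [← Matrix.smul_single, map_smul, Matrix.mul_smul, Matrix.smul_mul, Matrix.smul_apply,
      RingHom.id_apply]

lemma coeffMap_apply (a : D) :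
    coeffMap e i₀ j₀ u v a = (v * e (.single i₀ i₀ a) * u) j₀ j₀ :=
  rfl

lemma coeffMap_one (huv : u * v = e (.single i₀ i₀ 1)) (hvu : v * u = .single j₀ j₀ 1) :
    coeffMap e i₀ j₀ u v 1 = 1 := by
  have h1 : v * (u * v) * u = v * u * (v * u) := by simp only [Matrix.mul_assoc]
  rw [coeffMap_apply, ← huv, h1, hvu, Matrix.single_mul_single_same, Matrix.single_apply_same,
    one_mul]

lemma coeffMap_mul (huv : u * v = e (.single i₀ i₀ 1)) (hu : u * .single j₀ j₀ 1 = u)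
    (hv : .single j₀ j₀ 1 * v = v) (a b : D) :
    coeffMap e i₀ j₀ u v (a * b) = coeffMap e i₀ j₀ u v a * coeffMap e i₀ j₀ u v b := by
  rw [coeffMap_apply, conj_mul_conj e huv, ← single_apply_conj e hu hv a,
    ← single_apply_conj e hu hv b, Matrix.single_mul_single_same, Matrix.single_apply_same,
    coeffMap_apply, coeffMap_apply]

lemma coeffMap_bijective (huv : u * v = e (.single i₀ i₀ 1)) (hvu : v * u = .single j₀ j₀ 1)
    (hu : u * .single j₀ j₀ 1 = u) (hv : .single j₀ j₀ 1 * v = v) :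
    Function.Bijective (coeffMap e i₀ j₀ u v) := by
  refine ⟨Function.LeftInverse.injective (g := fun b => e.symm (u * .single j₀ j₀ b * v) i₀ i₀)
    fun a => ?_, fun b => ⟨e.symm (u * .single j₀ j₀ b * v) i₀ i₀, ?_⟩⟩
  · beta_reduce
    rw [coeffMap_apply, single_apply_conj e hu hv, mul_conj_mul e huv, AlgEquiv.symm_apply_apply,
      Matrix.single_apply_same]
  · rw [coeffMap_apply, single_symm_apply e huv hvu hu hv, AlgEquiv.apply_symm_apply,
      mul_single_mul hvu, Matrix.single_apply_same]

/-- The isomorphism of coefficient algebras induced by an isomorphism of matrix algebras and an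
equivalence between images of diagonal matrix units. -/
noncomputable def coeffEquiv (huv : u * v = e (.single i₀ i₀ 1))
    (hvu : v * u = .single j₀ j₀ 1) (hu : u * .single j₀ j₀ 1 = u)
    (hv : .single j₀ j₀ 1 * v = v) : D ≃ₐ[F] D' :=
  AlgEquiv.ofBijective
    (AlgHom.ofLinearMap (coeffMap e i₀ j₀ u v) (coeffMap_one e huv hvu)
      (coeffMap_mul e huv hu hv))
    (coeffMap_bijective e huv hvu hu hv)

lemma coeffEquiv_apply (huv : u * v = e (.single i₀ i₀ 1)) (hvu : v * u = .single j₀ j₀ 1)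
    (hu : u * .single j₀ j₀ 1 = u) (hv : .single j₀ j₀ 1 * v = v) (a : D) :
    coeffEquiv e huv hvu hu hv a = (v * e (.single i₀ i₀ a) * u) j₀ j₀ :=
  rfl

lemma mem_iff_coeffEquiv (h𝒟' : IsDivisionFamily 𝒟')
    (he : ∀ p X, IsHomogeneousMatrix 𝒟 h p X ↔ IsHomogeneousMatrix 𝒟' h' p (e X))
    (hdu : IsHomogeneousMatrix 𝒟' h' 0 u) (hdv : IsHomogeneousMatrix 𝒟' h' 0 v)
    (huv : u * v = e (.single i₀ i₀ 1)) (hvu : v * u = .single j₀ j₀ 1)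
    (hu : u * .single j₀ j₀ 1 = u) (hv : .single j₀ j₀ 1 * v = v) (q : H) (a : D) :
    a ∈ 𝒟 q ↔ coeffEquiv e huv hvu hu hv a ∈ 𝒟' q := by
  rw [coeffEquiv_apply]
  constructor
  · intro ha
    have h1 := (he q _).1 (.single (i := i₀) (j := i₀) (by rwa [sub_add_cancel]))
    have h2 := ((hdv.mul h𝒟' h1).mul h𝒟' hdu) j₀ j₀
    rwa [zero_add, add_zero, sub_add_cancel] at h2
  · intro ha
    have h1 : IsHomogeneousMatrix 𝒟' h' q
        (.single j₀ j₀ ((v * e (.single i₀ i₀ a) * u) j₀ j₀)) := .single (by rwa [sub_add_cancel])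
    have h2 := (hdu.mul h𝒟' h1).mul h𝒟' hdv
    rw [single_apply_conj e hu hv, mul_conj_mul e huv, ← he] at h2
    have h3 := h2 i₀ i₀
    rwa [zero_add, add_zero, sub_add_cancel, Matrix.single_apply_same] at h3

lemma sum_finrank_le [FiniteDimensional F D] [FiniteDimensional F D'] (h𝒟' : IsDivisionFamily 𝒟')
    (he : ∀ p X, IsHomogeneousMatrix 𝒟 h p X ↔ IsHomogeneousMatrix 𝒟' h' p (e X))
    (hdu : IsHomogeneousMatrix 𝒟' h' 0 u) (huv : u * v = e (.single i₀ i₀ 1))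
    (hu : u * .single j₀ j₀ 1 = u) (q : H) :
    ∑ i, Module.finrank F (𝒟 (q - h i + h i₀)) ≤
      ∑ k, Module.finrank F (𝒟' (q - h' k + h' j₀)) := by
  let col : (∀ i, 𝒟 (q - h i + h i₀)) →ₗ[F] Matrix ι ι D :=
    { toFun := fun x => .of fun i j => if j = i₀ then (x i : D) else 0
      map_add' := fun x y => by
        ext i j
        by_cases hj : j = i₀ <;> simp [hj]
      map_smul' := fun c x => by
        ext i j
        by_cases hj : j = i₀ <;> simp [hj] }
  have hcol : ∀ x, IsHomogeneousMatrix 𝒟 h q (col x) := fun x i j => by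
    change (if j = i₀ then (x i : D) else 0) ∈ _
    split_ifs with hj
    · rw [hj]
      exact (x i).2
    · exact zero_mem _
  have hcols : ∀ x, col x * .single i₀ i₀ 1 = col x := fun x => by
    ext i j
    by_cases hj : j = i₀
    · subst hj
      simp
    · rw [Matrix.mul_single_apply_of_ne _ _ _ _ _ hj]
      exact (if_neg hj).symm
  let Ψ : (∀ i, 𝒟 (q - h i + h i₀)) →ₗ[F] ∀ k, 𝒟' (q - h' k + h' j₀) :=
    LinearMap.pi fun k => LinearMap.codRestrict _
      { toFun := fun x => (e (col x) * u) k j₀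
        map_add' := fun x y => by rw [map_add, map_add, Matrix.add_mul, Matrix.add_apply]
        map_smul' := fun c x => by
          rw [map_smul, map_smul, Matrix.smul_mul, Matrix.smul_apply, RingHom.id_apply] }
      fun x => by
        have h1 := (((he _ _).1 (hcol x)).mul h𝒟' hdu) k j₀
        rwa [add_zero] at h1
  have hΨ : Function.Injective Ψ := by
    rw [injective_iff_map_eq_zero]
    intro x hx
    have h1 : ∀ k, (e (col x) * u) k j₀ = 0 := fun k => congrArg Subtype.val (congrFun hx k)
    have h2 : e (col x) * u = 0 := by
      rw [← hu, ← Matrix.mul_assoc]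
      ext k l
      by_cases hl : l = j₀
      · subst hl
        simp [h1]
      · rw [Matrix.mul_single_apply_of_ne _ _ _ _ _ hl, Matrix.zero_apply]
    have h3 : e (col x) = 0 := by
      rw [← hcols, map_mul, ← huv, ← Matrix.mul_assoc, h2, Matrix.zero_mul]
    have h4 : col x = 0 := (map_eq_zero_iff e e.injective).1 h3
    ext i
    have h5 : (if i₀ = i₀ then (x i : D) else 0) = 0 := congrFun (congrFun h4 i) i₀
    simpa using h5
  have h1 := LinearMap.finrank_le_finrank_of_injective hΨ
  rwa [Module.finrank_pi_fintype, Module.finrank_pi_fintype] at h1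

lemma sum_finrank_eq [FiniteDimensional F D] [FiniteDimensional F D']
    (h𝒟 : IsDivisionFamily 𝒟) (h𝒟' : IsDivisionFamily 𝒟')
    (he : ∀ p X, IsHomogeneousMatrix 𝒟 h p X ↔ IsHomogeneousMatrix 𝒟' h' p (e X))
    (hdu : IsHomogeneousMatrix 𝒟' h' 0 u) (hdv : IsHomogeneousMatrix 𝒟' h' 0 v)
    (huv : u * v = e (.single i₀ i₀ 1)) (hvu : v * u = .single j₀ j₀ 1)
    (hu : u * .single j₀ j₀ 1 = u) (hv : .single j₀ j₀ 1 * v = v) (q : H) :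
    ∑ i, Module.finrank F (𝒟 (q - h i + h i₀)) =
      ∑ k, Module.finrank F (𝒟' (q - h' k + h' j₀)) := by
  refine (sum_finrank_le e h𝒟' he hdu huv hu q).antisymm ?_
  refine sum_finrank_le e.symm (u := e.symm v) (v := e.symm u) h𝒟 (fun p X => ?_) ?_ ?_ ?_ q
  · rw [he, AlgEquiv.apply_symm_apply]
  · rwa [he, AlgEquiv.apply_symm_apply]
  · rw [← map_mul, hvu]
  · refine e.injective ?_
    rw [map_mul, AlgEquiv.apply_symm_apply, ← huv, ← Matrix.mul_assoc, hvu, hv]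

end Linked

lemma IsDivisionFamily.finrank_eq [Nontrivial D] [FiniteDimensional F D]
    (h𝒟 : IsDivisionFamily 𝒟) {q : H} (hq : 𝒟 q ≠ ⊥) :
    Module.finrank F (𝒟 q) = Module.finrank F (𝒟 0) := by
  obtain ⟨x, hx, hx0⟩ := Submodule.exists_mem_ne_zero_of_ne_bot hq
  obtain ⟨y, hy, hxy, hyx⟩ := h𝒟.exists_inv hx hx0
  refine le_antisymm ?_ ?_
  · refine LinearMap.finrank_le_finrank_of_injective
      (f := (LinearMap.mulRight F y).restrict (p := 𝒟 q) (q := 𝒟 0) fun z hz => by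
        simpa using h𝒟.mul_mem hz hy) ?_
    intro z w hzw
    have h1 : (z : D) * y = w * y := congrArg Subtype.val hzw
    exact Subtype.ext (by rw [← mul_one (z : D), ← hyx, ← mul_assoc, h1, mul_assoc, hyx, mul_one])
  · refine LinearMap.finrank_le_finrank_of_injective
      (f := (LinearMap.mulRight F x).restrict (p := 𝒟 0) (q := 𝒟 q) fun z hz => by
        simpa using h𝒟.mul_mem hz hx) ?_
    intro z w hzw
    have h1 : (z : D) * x = w * x := congrArg Subtype.val hzw
    exact Subtype.ext (by rw [← mul_one (z : D), ← hxy, ← mul_assoc, h1, mul_assoc, hxy, mul_one])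

lemma IsDivisionFamily.sum_finrank [Nontrivial D] [FiniteDimensional F D]
    {κ : Type*} [Fintype κ] (h𝒟 : IsDivisionFamily 𝒟) (q : κ → H)
    [DecidablePred fun i => 𝒟 (q i) ≠ ⊥] :
    ∑ i, Module.finrank F (𝒟 (q i)) =
      (Finset.univ.filter fun i => 𝒟 (q i) ≠ ⊥).card * Module.finrank F (𝒟 0) := by
  rw [Finset.card_filter, Finset.sum_mul]
  refine Finset.sum_congr rfl fun i _ => ?_
  split_ifs with hi
  · rw [h𝒟.finrank_eq hi, one_mul]
  · rw [not_not.1 hi, finrank_bot, zero_mul]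

/-- A graded isomorphism of matrix algebras over graded division algebras induces a graded
isomorphism of the coefficient algebras, and it matches the degrees of the rows modulo the
support up to a common translation. -/
theorem exists_coeffEquiv [Nontrivial D] [FiniteDimensional F D] [FiniteDimensional F D']
    (h𝒟 : IsDivisionFamily 𝒟) (h𝒟' : IsDivisionFamily 𝒟') {h : ι → H} {h' : ι' → H}
    (e : Matrix ι ι D ≃ₐ[F] Matrix ι' ι' D')
    (he : ∀ p X, IsHomogeneousMatrix 𝒟 h p X ↔ IsHomogeneousMatrix 𝒟' h' p (e X)) [Nonempty ι] :
    ∃ (f : D ≃ₐ[F] D') (s : H), (∀ q a, a ∈ 𝒟 q ↔ f a ∈ 𝒟' q) ∧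
      ∀ r, Nat.card {i // 𝒟 (r - h i) ≠ ⊥} = Nat.card {k // 𝒟 (r + s - h' k) ≠ ⊥} := by
  classical
  obtain ⟨i₀⟩ := ‹Nonempty ι›
  obtain ⟨j₀, u, v, hdu, hdv, huv, hvu, hu, hv⟩ := exists_equiv_diagonal h𝒟 h𝒟' e he i₀
  have hf := mem_iff_coeffEquiv e h𝒟' he hdu hdv huv hvu hu hv
  refine ⟨coeffEquiv e huv hvu hu hv, h' j₀ - h i₀, hf, fun r => ?_⟩
  have hfr : ∀ q, Module.finrank F (𝒟' q) = Module.finrank F (𝒟 q) := fun q => by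
    rw [← map_eq_of_mem_iff _ (hf q)]
    exact LinearEquiv.finrank_map_eq (coeffEquiv e huv hvu hu hv).toLinearEquiv (𝒟 q)
  have hpos : 0 < Module.finrank F (𝒟 0) := Module.finrank_pos_iff_exists_ne_zero.2
    ⟨⟨1, h𝒟.one_mem⟩, fun h => one_ne_zero (congrArg Subtype.val h)⟩
  have h1 := sum_finrank_eq e h𝒟 h𝒟' he hdu hdv huv hvu hu hv (r - h i₀)
  simp only [hfr] at h1
  rw [h𝒟.sum_finrank, h𝒟.sum_finrank] at h1
  have h2 := Nat.eq_of_mul_eq_mul_right hpos h1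
  rw [Nat.card_eq_fintype_card, Nat.card_eq_fintype_card, Fintype.card_subtype,
    Fintype.card_subtype]
  convert h2 using 5 with i i
  · abel
  · abel

end Matrix

lemma nat_card_subtype_sum {α β : Type*} [Finite α] [Finite β] (P : α ⊕ β → Prop) :
    Nat.card {c // P c} = Nat.card {a // P (.inl a)} + Nat.card {b // P (.inr b)} := by
  rw [Nat.card_congr (Equiv.subtypeSum (p := P)), Nat.card_sum]

lemma count_Xi (T : Subgroup G) [DecidableEq (G ⧸ T)] (g : G) {k : ℕ} (γ : Fin k → G) (x : G) :
    (Xi T g γ).count (x : G ⧸ T) = Nat.card {i // (g * γ i)⁻¹ * x ∈ T} := by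
  classical
  rw [Xi, Multiset.count_map, Nat.card_eq_fintype_card, Fintype.card_subtype, Finset.card_def,
    Finset.filter_val]
  congr 1
  refine Multiset.filter_congr fun i _ => ?_
  rw [eq_comm, QuotientGroup.eq]

lemma isDivisionFamily_of_isGradedDivision [DecidableEq G] {E : GrAlg.{u, v, w} F (ℤ × G)}
    (hE : IsGradedDivision E) : IsDivisionFamily (additiveGr E.gr) := by
  obtain ⟨⟨hint, hone, hmul⟩, -, hdiv⟩ := hE
  let _ : GradedAlgebra (additiveGr E.gr) :=
    { one_mem := hone
      mul_mem := fun {p q} x y hx hy => hmul _ _ x hx y hy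
      toDecomposition := DirectSum.IsInternal.chooseDecomposition (additiveGr E.gr)
        (isInternal_additiveGr.2 hint) }
  refine ⟨hone, fun hx hy => hmul _ _ _ hx _ hy, fun {p x} hx hx0 => ?_⟩
  obtain ⟨y, hxy, hyx⟩ := isUnit_iff_exists.1 (hdiv _ x hx hx0)
  obtain ⟨z, hz, hzx⟩ := exists_homogeneous_left (additiveGr E.gr) hx
    (SetLike.GradedOne.one_mem (A := additiveGr E.gr)) hyx
  rw [zero_sub] at hz
  exact ⟨z, hz, left_inv_eq_right_inv hzx hxy ▸ hxy, hzx⟩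

section

variable {D D' : Type w} [Ring D] [Algebra F D] [Ring D'] [Algebra F D']
  {Dgr : ℤ × G → Submodule F D} {Dgr' : ℤ × G → Submodule F D'} {k₀ k₁ k₀' k₁' : ℕ}
  {γ₀ : Fin k₀ → G} {γ₁ : Fin k₁ → G} {γ₀' : Fin k₀' → G} {γ₁' : Fin k₁' → G}

lemma isHomogeneousMatrix_iff_mem_matGr {ι : Type*} (γ : ι → G) (δ : ι → ℤ)
    (p : ℤ × Additive G) (X : Matrix ι ι D) :
    IsHomogeneousMatrix (additiveGr Dgr) (fun i => (δ i, .ofMul (γ i))) p X ↔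
      X ∈ matGr Dgr γ δ (p.1, p.2.toMul) :=
  (mem_matGr_iff Dgr γ δ p X).symm

theorem exists_equiv_and_Xi_eq [Nontrivial D] [FiniteDimensional F D] [FiniteDimensional F D']
    (hD : IsDivisionFamily (additiveGr Dgr)) (hD' : IsDivisionFamily (additiveGr Dgr'))
    {T : Subgroup G} (hT : ∀ g : G, g ∈ T ↔ Dgr (0, g) ≠ ⊥)
    (hsupp : ∀ p : ℤ × G, Dgr p ≠ ⊥ → p.1 = 0) (hk₀ : 1 ≤ k₀) (hk₁ : 1 ≤ k₁)
    (e : Matrix (Fin k₀ ⊕ Fin k₁) (Fin k₀ ⊕ Fin k₁) D ≃ₐ[F]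
      Matrix (Fin k₀' ⊕ Fin k₁') (Fin k₀' ⊕ Fin k₁') D')
    (he : ∀ p X, X ∈ matGr Dgr (Sum.elim γ₀ γ₁) (delta01 k₀ k₁) p ↔
      e X ∈ matGr Dgr' (Sum.elim γ₀' γ₁') (delta01 k₀' k₁') p) :
    (∃ f : D ≃ₐ[F] D', ∀ p a, a ∈ Dgr p ↔ f a ∈ Dgr' p) ∧
      ∃ g : G, Xi T 1 γ₀ = Xi T g γ₀' ∧ Xi T 1 γ₁ = Xi T g γ₁' := by
  classical
  have : Nonempty (Fin k₀) := ⟨⟨0, hk₀⟩⟩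
  have : Nonempty (Fin k₁) := ⟨⟨0, hk₁⟩⟩
  obtain ⟨f, s, hf, hcard⟩ := exists_coeffEquiv hD hD'
    (h := fun i => (delta01 k₀ k₁ i, .ofMul (Sum.elim γ₀ γ₁ i)))
    (h' := fun i => (delta01 k₀' k₁' i, .ofMul (Sum.elim γ₀' γ₁' i))) e fun p X => by
      rw [isHomogeneousMatrix_iff_mem_matGr, isHomogeneousMatrix_iff_mem_matGr]
      exact he _ _
  refine ⟨⟨f, fun p a => hf (p.1, .ofMul p.2) a⟩, ?_⟩
  have hne : ∀ (m : ℤ) (x : G), Dgr (m, x) ≠ ⊥ ↔ m = 0 ∧ x ∈ T := fun m x =>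
    ⟨fun h => by
      obtain rfl : m = 0 := hsupp _ h
      exact ⟨rfl, (hT x).2 h⟩, fun h => by
      rw [h.1]
      exact (hT x).1 h.2⟩
  have hcard' : ∀ (m : ℤ) (x : G),
      Nat.card {i // m = 0 ∧ (1 * γ₀ i)⁻¹ * x ∈ T} +
        Nat.card {i // m - 1 = 0 ∧ (1 * γ₁ i)⁻¹ * x ∈ T} =
      Nat.card {i // m + s.1 = 0 ∧ (s.2.toMul⁻¹ * γ₀' i)⁻¹ * x ∈ T} +
        Nat.card {i // m + s.1 - 1 = 0 ∧ (s.2.toMul⁻¹ * γ₁' i)⁻¹ * x ∈ T} := by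
    intro m x
    have h1 := hcard (m, .ofMul x)
    rw [nat_card_subtype_sum, nat_card_subtype_sum] at h1
    refine (congrArg₂ (· + ·) ?_ ?_).trans (h1.trans (congrArg₂ (· + ·) ?_ ?_)) <;>
      refine Nat.card_congr (Equiv.subtypeEquivRight fun i => ?_)
    · rw [← hne]
      simp [additiveGr, delta01, div_eq_inv_mul]
    · rw [← hne]
      simp [additiveGr, delta01, div_eq_inv_mul]
    · rw [← hne]
      simp [additiveGr, delta01, div_eq_inv_mul, mul_comm, mul_left_comm]
    · rw [← hne]
      simp [additiveGr, delta01, div_eq_inv_mul, mul_comm, mul_left_comm]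
  have hs : s.1 = 0 := by
    have h0 := hcard' 0 (γ₀ ⟨0, hk₀⟩)
    have h1 := hcard' 1 (γ₁ ⟨0, hk₁⟩)
    have hpos₀ : 0 < Nat.card {i // (0 : ℤ) = 0 ∧ (1 * γ₀ i)⁻¹ * γ₀ ⟨0, hk₀⟩ ∈ T} :=
      Nat.card_pos_iff.2 ⟨⟨⟨0, hk₀⟩, rfl, by simp⟩, inferInstance⟩
    have hpos₁ : 0 < Nat.card {i // (1 : ℤ) - 1 = 0 ∧ (1 * γ₁ i)⁻¹ * γ₁ ⟨0, hk₁⟩ ∈ T} :=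
      Nat.card_pos_iff.2 ⟨⟨⟨0, hk₁⟩, rfl, by simp⟩, inferInstance⟩
    have hzero : ∀ (α : Type) (m : ℤ) (P : α → Prop), m ≠ 0 → Nat.card {i // m = 0 ∧ P i} = 0 :=
      fun α m P hm => by simp [hm]
    by_cases h2 : 0 + s.1 = 0
    · omega
    · rw [hzero _ (0 + s.1) _ h2] at h0
      by_cases h3 : 0 + s.1 - 1 = 0
      · rw [hzero _ (1 + s.1) _ (by omega), hzero _ (1 + s.1 - 1) _ (by omega)] at h1
        omega
      · rw [hzero _ _ _ h3] at h0
        omega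
  refine ⟨s.2.toMul⁻¹, Multiset.ext.2 fun c => ?_, Multiset.ext.2 fun c => ?_⟩ <;>
    obtain ⟨x, rfl⟩ := QuotientGroup.mk_surjective c
  · have h1 := hcard' 0 x
    simp only [hs] at h1
    rw [count_Xi, count_Xi]
    simpa using h1
  · have h1 := hcard' 1 x
    simp only [hs] at h1
    rw [count_Xi, count_Xi]
    simpa using h1

end

section Rescaling

variable {H : Type*} [AddCommGroup H] {D D' : Type*} [Ring D] [Algebra F D] [Ring D']
  [Algebra F D'] {𝒟 : H → Submodule F D} {𝒟' : H → Submodule F D'} {ι ι' : Type*}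

lemma IsDivisionFamily.mul_mul_mem_iff (h𝒟 : IsDivisionFamily 𝒟) {p q r : H} {x x' y y' : D}
    (hx : x ∈ 𝒟 p) (hx' : x' ∈ 𝒟 (-p)) (hxx : x' * x = 1) (hy : y ∈ 𝒟 q) (hy' : y' ∈ 𝒟 (-q))
    (hyy : y * y' = 1) (a : D) : a ∈ 𝒟 r ↔ x * a * y ∈ 𝒟 (p + r + q) := by
  refine ⟨fun ha => h𝒟.mul_mem (h𝒟.mul_mem hx ha) hy, fun ha => ?_⟩
  have h1 := h𝒟.mul_mem (h𝒟.mul_mem hx' ha) hy'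
  have h2 : x' * (x * a * y) * y' = a := by
    calc x' * (x * a * y) * y' = x' * x * a * (y * y') := by simp only [mul_assoc]
      _ = a := by rw [hxx, hyy, one_mul, mul_one]
  rwa [h2, show -p + (p + r + q) + -q = r by abel] at h1

variable [Fintype ι] [DecidableEq ι]

/-- Conjugation by an invertible diagonal matrix. -/
def diagonalConj (x y : ι → D) (hxy : ∀ i, x i * y i = 1) (hyx : ∀ i, y i * x i = 1) :
    Matrix ι ι D ≃ₐ[F] Matrix ι ι D :=
  have h₁ : Matrix.diagonal x * Matrix.diagonal y = 1 := by
    rw [Matrix.diagonal_mul_diagonal, funext hxy, Matrix.diagonal_one]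
  have h₂ : Matrix.diagonal y * Matrix.diagonal x = 1 := by
    rw [Matrix.diagonal_mul_diagonal, funext hyx, Matrix.diagonal_one]
  MulSemiringAction.toAlgEquiv F (Matrix ι ι D)
    (ConjAct.toConjAct (⟨Matrix.diagonal x, Matrix.diagonal y, h₁, h₂⟩ : (Matrix ι ι D)ˣ))

lemma diagonalConj_apply (x y : ι → D) (hxy : ∀ i, x i * y i = 1) (hyx : ∀ i, y i * x i = 1)
    (X : Matrix ι ι D) (i j : ι) :
    diagonalConj (F := F) x y hxy hyx X i j = x i * X i j * y j := by
  change (Matrix.diagonal x * X * Matrix.diagonal y) i j = _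
  rw [Matrix.mul_diagonal, Matrix.diagonal_mul]

variable [Fintype ι'] [DecidableEq ι']

lemma exists_matrix_equiv (h𝒟 : IsDivisionFamily 𝒟) (f : D ≃ₐ[F] D')
    (hf : ∀ p a, a ∈ 𝒟 p ↔ f a ∈ 𝒟' p) {h : ι → H} {h' : ι' → H} (σ : ι ≃ ι') (c : H)
    (hσ : ∀ i, 𝒟 (h i - h' (σ i) - c) ≠ ⊥) :
    ∃ e : Matrix ι ι D ≃ₐ[F] Matrix ι' ι' D',
      ∀ p X, IsHomogeneousMatrix 𝒟 h p X ↔ IsHomogeneousMatrix 𝒟' h' p (e X) := by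
  have hunit : ∀ i, ∃ x ∈ 𝒟 (h i - h' (σ i) - c), ∃ y ∈ 𝒟 (-(h i - h' (σ i) - c)),
      x * y = 1 ∧ y * x = 1 := fun i => by
    obtain ⟨x, hx, hx0⟩ := Submodule.exists_mem_ne_zero_of_ne_bot (hσ i)
    exact ⟨x, hx, h𝒟.exists_inv hx hx0⟩
  choose x hx y hy hxy hyx using hunit
  refine ⟨((diagonalConj x y hxy hyx).trans f.mapMatrix).trans (Matrix.reindexAlgEquiv F D' σ),
    fun p X => ?_⟩
  have happ : ∀ i j, (((diagonalConj x y hxy hyx).trans f.mapMatrix).trans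
      (Matrix.reindexAlgEquiv F D' σ)) X (σ i) (σ j) = f (x i * X i j * y j) := fun i j => by
    rw [← diagonalConj_apply (F := F) x y hxy hyx]
    simp
  have hmem : ∀ i j, X i j ∈ 𝒟 (p - h i + h j) ↔
      f (x i * X i j * y j) ∈ 𝒟' (p - h' (σ i) + h' (σ j)) := fun i j => by
    rw [h𝒟.mul_mul_mem_iff (hx i) (hy i) (hyx i) (hy j) (by rw [neg_neg]; exact hx j) (hyx j),
      hf, show h i - h' (σ i) - c + (p - h i + h j) + -(h j - h' (σ j) - c) =
        p - h' (σ i) + h' (σ j) by abel]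
  constructor
  · intro hX k l
    obtain ⟨i, rfl⟩ := σ.surjective k
    obtain ⟨j, rfl⟩ := σ.surjective l
    rw [happ, ← hmem]
    exact hX i j
  · intro hX i j
    rw [hmem, ← happ]
    exact hX _ _

end Rescaling

lemma exists_equiv_of_Xi_eq {T : Subgroup G} {a b : G} {k k' : ℕ} {γ : Fin k → G}
    {γ' : Fin k' → G} (h : Xi T a γ = Xi T b γ') :
    ∃ σ : Fin k ≃ Fin k', ∀ i, (b * γ' (σ i))⁻¹ * (a * γ i) ∈ T := by
  classical
  have hfiber : ∀ c : G ⧸ T, Nonempty ({i // ((a * γ i : G) : G ⧸ T) = c} ≃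
      {i // ((b * γ' i : G) : G ⧸ T) = c}) := fun c => by
    obtain ⟨x, rfl⟩ := QuotientGroup.mk_surjective c
    simp only [QuotientGroup.eq]
    refine Finite.card_eq.1 ?_
    rw [← count_Xi, ← count_Xi]
    exact congrArg _ h
  exact ⟨Equiv.ofFiberEquiv fun c => (hfiber c).some, fun i =>
    QuotientGroup.eq.1 (Equiv.ofFiberEquiv_map (fun c => (hfiber c).some) i)⟩

section

variable {D D' : Type w} [Ring D] [Algebra F D] [Ring D'] [Algebra F D']
  {Dgr : ℤ × G → Submodule F D} {Dgr' : ℤ × G → Submodule F D'} {k₀ k₁ k₀' k₁' : ℕ}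
  {γ₀ : Fin k₀ → G} {γ₁ : Fin k₁ → G} {γ₀' : Fin k₀' → G} {γ₁' : Fin k₁' → G}

theorem exists_matrix_equiv_of_Xi_eq (hD : IsDivisionFamily (additiveGr Dgr)) {T : Subgroup G}
    (hT : ∀ g : G, g ∈ T ↔ Dgr (0, g) ≠ ⊥) (f : D ≃ₐ[F] D')
    (hf : ∀ p a, a ∈ Dgr p ↔ f a ∈ Dgr' p) {g : G} (h₀ : Xi T 1 γ₀ = Xi T g γ₀')
    (h₁ : Xi T 1 γ₁ = Xi T g γ₁') :
    ∃ e : Matrix (Fin k₀ ⊕ Fin k₁) (Fin k₀ ⊕ Fin k₁) D ≃ₐ[F]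
        Matrix (Fin k₀' ⊕ Fin k₁') (Fin k₀' ⊕ Fin k₁') D',
      ∀ p X, X ∈ matGr Dgr (Sum.elim γ₀ γ₁) (delta01 k₀ k₁) p ↔
        e X ∈ matGr Dgr' (Sum.elim γ₀' γ₁') (delta01 k₀' k₁') p := by
  obtain ⟨σ₀, hσ₀⟩ := exists_equiv_of_Xi_eq h₀
  obtain ⟨σ₁, hσ₁⟩ := exists_equiv_of_Xi_eq h₁
  obtain ⟨e, he⟩ := exists_matrix_equiv (𝒟' := additiveGr Dgr') hD f
    (fun p a => hf (p.1, p.2.toMul) a)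
    (h := fun i => (delta01 k₀ k₁ i, .ofMul (Sum.elim γ₀ γ₁ i)))
    (h' := fun i => (delta01 k₀' k₁' i, .ofMul (Sum.elim γ₀' γ₁' i)))
    (Equiv.sumCongr σ₀ σ₁) (0, .ofMul g) (by
      rintro (i | i)
      · have h2 := (hT _).1 (hσ₀ i)
        simpa [additiveGr, delta01, div_eq_mul_inv, mul_comm, mul_left_comm] using h2
      · have h2 := (hT _).1 (hσ₁ i)
        simpa [additiveGr, delta01, div_eq_mul_inv, mul_comm, mul_left_comm] using h2)
  refine ⟨e, fun p X => ?_⟩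
  have h2 := he (p.1, .ofMul p.2) X
  rwa [isHomogeneousMatrix_iff_mem_matGr, isHomogeneousMatrix_iff_mem_matGr] at h2

end

end GradedSimple

theorem stmt_8
    (F : Type u) [Field F] (hchar : ringChar F ≠ 2)
    (G : Type v) [CommGroup G] [DecidableEq G] (hG : Group.FG G)
    (A : Type w) [Ring A] [Algebra F A] [FiniteDimensional F A]
    -- A is simple
    (hAnontriv : Nontrivial A)
    (hAsimple : ∀ K : Submodule F A,
      (∀ a : A, ∀ x ∈ K, a * x ∈ K ∧ x * a ∈ K) → K = ⊥ ∨ K = ⊤)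
    -- the (ℤ×G)-grading Γ with induced ℤ-support {−1,0,1}
    (Γ : ℤ × G → Submodule F A)
    (hinternal : DirectSum.IsInternal Γ)
    (hone : (1 : A) ∈ Γ (0, 1))
    (hgrmul : ∀ p q : ℤ × G, ∀ x ∈ Γ p, ∀ y ∈ Γ q, x * y ∈ Γ (p.1 + q.1, p.2 * q.2))
    (hsupp₁ : ∀ p : ℤ × G, Γ p ≠ ⊥ → p.1 = -1 ∨ p.1 = 0 ∨ p.1 = 1)
    (hsupp₂ : ∃ g : G, Γ (-1, g) ≠ ⊥)
    (hsupp₃ : ∃ g : G, Γ (0, g) ≠ ⊥)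
    (hsupp₄ : ∃ g : G, Γ (1, g) ≠ ⊥) :
    -- first part: (A,Γ) ≅ M(G,D,γ₀,γ₁)
    (∃ (D : GrAlg.{u, v, w} F (ℤ × G)) (k₀ k₁ : ℕ) (γ₀ : Fin k₀ → G) (γ₁ : Fin k₁ → G),
      IsGradedDivision D ∧ 1 ≤ k₀ ∧ 1 ≤ k₁ ∧
      ∃ e : A ≃ₐ[F] Matrix (Fin k₀ ⊕ Fin k₁) (Fin k₀ ⊕ Fin k₁) D.carrier,
        ∀ p : ℤ × G,
          Submodule.map (e : A →ₗ[F] Matrix (Fin k₀ ⊕ Fin k₁) (Fin k₀ ⊕ Fin k₁) D.carrier)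
              (Γ p)
            = matGr D.gr (Sum.elim γ₀ γ₁) (delta01 k₀ k₁) p) ∧
    -- second part: the isomorphism condition for two such models
    (∀ (D D' : GrAlg.{u, v, w} F (ℤ × G)), IsGradedDivision D → IsGradedDivision D' →
      -- T = supp D (the support of a graded division algebra, a finite subgroup of {0}×G,
      -- identified with a subgroup of G)
      ∀ T : Subgroup G, (∀ g : G, g ∈ T ↔ D.gr (0, g) ≠ ⊥) →
      (∀ p : ℤ × G, D.gr p ≠ ⊥ → p.1 = 0) → (∀ p : ℤ × G, D'.gr p ≠ ⊥ → p.1 = 0) →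
      ∀ (k₀ k₁ k₀' k₁' : ℕ), 1 ≤ k₀ → 1 ≤ k₁ → 1 ≤ k₀' → 1 ≤ k₁' →
      ∀ (γ₀ : Fin k₀ → G) (γ₁ : Fin k₁ → G) (γ₀' : Fin k₀' → G) (γ₁' : Fin k₁' → G),
      ((∃ e : Matrix (Fin k₀ ⊕ Fin k₁) (Fin k₀ ⊕ Fin k₁) D.carrier ≃ₐ[F]
            Matrix (Fin k₀' ⊕ Fin k₁') (Fin k₀' ⊕ Fin k₁') D'.carrier,
          ∀ p : ℤ × G,
            Submodule.map
                (e : Matrix (Fin k₀ ⊕ Fin k₁) (Fin k₀ ⊕ Fin k₁) D.carrier →ₗ[F]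
                  Matrix (Fin k₀' ⊕ Fin k₁') (Fin k₀' ⊕ Fin k₁') D'.carrier)
                (matGr D.gr (Sum.elim γ₀ γ₁) (delta01 k₀ k₁) p)
              = matGr D'.gr (Sum.elim γ₀' γ₁') (delta01 k₀' k₁') p) ↔
        ((∃ f : D.carrier ≃ₐ[F] D'.carrier,
            ∀ p : ℤ × G, Submodule.map (f : D.carrier →ₗ[F] D'.carrier) (D.gr p) = D'.gr p) ∧
          ∃ g : G, Xi T 1 γ₀ = Xi T g γ₀' ∧ Xi T 1 γ₁ = Xi T g γ₁'))) := by
  classical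
  refine ⟨GradedSimple.exists_matrix_model A hAsimple Γ hinternal hone hgrmul hsupp₁ hsupp₄, ?_⟩
  intro D D' hD hD' T hT hsD _ k₀ k₁ k₀' k₁' hk₀ hk₁ _ _ γ₀ γ₁ γ₀' γ₁'
  have : FiniteDimensional F D.carrier := hD.2.1
  have : FiniteDimensional F D'.carrier := hD'.2.1
  have : Nontrivial D.carrier := by
    obtain ⟨x, -, hx⟩ := Submodule.exists_mem_ne_zero_of_ne_bot ((hT 1).1 T.one_mem)
    exact ⟨⟨x, 0, hx⟩⟩
  have hdiv := GradedSimple.isDivisionFamily_of_isGradedDivision hD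
  constructor
  · rintro ⟨e, he⟩
    obtain ⟨⟨f, hf⟩, hg⟩ := GradedSimple.exists_equiv_and_Xi_eq hdiv
      (GradedSimple.isDivisionFamily_of_isGradedDivision hD') hT hsD hk₀ hk₁ e
      fun p => GradedSimple.mem_iff_of_map_eq e (he p)
    exact ⟨⟨f, fun p => GradedSimple.map_eq_of_mem_iff f (hf p)⟩, hg⟩
  · rintro ⟨⟨f, hf⟩, g, h₀, h₁⟩
    obtain ⟨e, he⟩ := GradedSimple.exists_matrix_equiv_of_Xi_eq hdiv hT f
      (fun p => GradedSimple.mem_iff_of_map_eq f (hf p)) h₀ h₁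
    exact ⟨e, fun p => GradedSimple.map_eq_of_mem_iff e (he p)⟩
end

section
/- Let I and J be finite-dimensional simple associative algebras over a field F of characteristic different from 2, with (ℤ×G)-gradings Γ_I and Γ_J (G a finitely generated abelian group) whose induced ℤ-gradings both have support {−1,0,1}. Then (I ⊕ I^op, ex, Γ_I^ex) is isomorphic to (J ⊕ J^op, ex, Γ_J^ex) as graded algebras with involution if and only if (I,Γ_I) is isomorphic as a graded algebra to either (J,Γ_J) or (J^op,Γ_J^op). -/
universe u v w

/-- The opposite grading on `A^op`: `(A^op)₍ᵢ,g₎ = A₍₋ᵢ,g₎`. -/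
def opGr {F : Type u} [Field F] {G : Type v} [CommGroup G] {A : Type w} [Ring A] [Algebra F A]
    (Γ : ℤ × G → Submodule F A) : ℤ × G → Submodule F Aᵐᵒᵖ :=
  fun p => (Γ (-p.1, p.2)).map (MulOpposite.opLinearEquiv F).toLinearMap

section Helpers

variable {F : Type*} [Field F]

/-- A linear bijection carries `P` onto `Q` iff membership in `P` is membership of the image in
`Q`. -/
lemma AlgEquiv.map_submodule_eq_iff {A B : Type*} [Ring A] [Algebra F A] [Ring B] [Algebra F B]
    (e : A ≃ₐ[F] B) (P : Submodule F A) (Q : Submodule F B) :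
    Submodule.map (e : A →ₗ[F] B) P = Q ↔ ∀ x, x ∈ P ↔ e x ∈ Q := by
  constructor
  · rintro rfl x
    constructor
    · intro hx
      exact ⟨x, hx, rfl⟩
    · rintro ⟨y, hy, hyx⟩
      obtain rfl : y = x := e.injective hyx
      exact hy
  · intro h
    ext y
    constructor
    · rintro ⟨x, hx, rfl⟩
      exact (h x).1 hx
    · intro hy
      exact ⟨e.symm y, (h _).2 (by simpa using hy), e.apply_symm_apply y⟩

/-- A central idempotent of a simple algebra is `0` or `1`. -/
lemma eq_zero_or_eq_one_of_central_idempotent {A : Type*} [Ring A] [Algebra F A]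
    (hA : ∀ K : Submodule F A, (∀ a : A, ∀ x ∈ K, a * x ∈ K ∧ x * a ∈ K) → K = ⊥ ∨ K = ⊤)
    {c : A} (hc : ∀ x, c * x = x * c) (hcc : c * c = c) : c = 0 ∨ c = 1 := by
  have hK := hA (LinearMap.range (LinearMap.mulLeft F c)) (by
    rintro a _ ⟨x, rfl⟩
    refine ⟨⟨a * x, ?_⟩, ⟨x * a, ?_⟩⟩
    · simp only [LinearMap.mulLeft_apply, ← mul_assoc, hc a]
    · simp only [LinearMap.mulLeft_apply, mul_assoc])
  refine hK.imp (fun h => ?_) (fun h => ?_)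
  · have hmem : c ∈ LinearMap.range (LinearMap.mulLeft F c) := ⟨1, by simp⟩
    simpa [h] using hmem
  · obtain ⟨x, hx⟩ : (1 : A) ∈ LinearMap.range (LinearMap.mulLeft F c) := by simp [h]
    rw [LinearMap.mulLeft_apply] at hx
    calc c = c * (c * x) := by rw [hx, mul_one]
      _ = 1 := by rw [← mul_assoc, hcc, hx]

/-- An isomorphism of products respecting the idempotent `(1, 0)` restricts to an isomorphism
of the first factors. -/
lemma AlgEquiv.exists_fst_of_map_one_zero {A B C D : Type*} [Ring A] [Algebra F A]
    [Ring B] [Algebra F B] [Ring C] [Algebra F C] [Ring D] [Algebra F D]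
    (e : (A × B) ≃ₐ[F] (C × D)) (he : e (1, 0) = (1, 0)) :
    ∃ f : A ≃ₐ[F] C, ∀ x, e (x, 0) = (f x, 0) := by
  have key : ∀ x, e (x, 0) = ((e (x, 0)).1, 0) := fun x => by
    have h : e (x, 0) = e (x, 0) * (1, 0) := by
      rw [← he, ← map_mul]
      simp
    refine Prod.ext rfl ?_
    rw [h]
    simp
  let φ : A →ₐ[F] C := AlgHom.ofLinearMap
    ((LinearMap.fst F C D).comp ((e : (A × B) →ₗ[F] (C × D)).comp (LinearMap.inl F A B)))
    (by simp [he])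
    (fun x y => by
      have h : e (x * y, 0) = e (x, 0) * e (y, 0) := by
        rw [← map_mul]
        simp
      exact congrArg Prod.fst h)
  refine ⟨AlgEquiv.ofBijective φ ⟨fun x y hxy => ?_, fun z => ?_⟩, key⟩
  · have h : e (x, 0) = e (y, 0) := by
      rw [key x, key y]
      exact congrArg (fun z => (z, 0)) hxy
    simpa using e.injective h
  · refine ⟨(e.symm (z, 0)).1, ?_⟩
    have h : ((e.symm (z, 0)).1, (0 : B)) = e.symm (z, 0) * (1, 0) := by
      ext <;> simp
    have h' : e ((e.symm (z, 0)).1, 0) = (z, 0) := by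
      rw [h, map_mul, he]
      simp
    exact congrArg Prod.fst h'

/-- Membership in the image of a submodule in the opposite algebra. -/
lemma mem_map_op_iff {A : Type*} [Ring A] [Algebra F A] (P : Submodule F A) (y : Aᵐᵒᵖ) :
    y ∈ P.map (MulOpposite.opLinearEquiv F).toLinearMap ↔ y.unop ∈ P := by
  constructor
  · rintro ⟨x, hx, rfl⟩
    exact hx
  · intro hy
    exact ⟨y.unop, hy, rfl⟩

/-- Swapping the factors of a product of algebras. -/
def AlgEquiv.prodSwap (A B : Type*) [Ring A] [Algebra F A] [Ring B] [Algebra F B] :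
    (A × B) ≃ₐ[F] (B × A) :=
  AlgEquiv.ofRingEquiv (f := RingEquiv.prodComm) fun _ => rfl

@[simp]
lemma AlgEquiv.prodSwap_apply {A B : Type*} [Ring A] [Algebra F A] [Ring B] [Algebra F B]
    (x : A × B) : AlgEquiv.prodSwap (F := F) A B x = x.swap := rfl

end Helpers

theorem stmt_9
    (F : Type u) [Field F] (hchar : ringChar F ≠ 2)
    (G : Type v) [CommGroup G] [DecidableEq G] (hG : Group.FG G)
    (I : Type w) [Ring I] [Algebra F I] [FiniteDimensional F I]
    (J : Type w) [Ring J] [Algebra F J] [FiniteDimensional F J]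
    -- I and J are simple algebras
    (hInontriv : Nontrivial I)
    (hIsimple : ∀ K : Submodule F I, (∀ a : I, ∀ x ∈ K, a * x ∈ K ∧ x * a ∈ K) → K = ⊥ ∨ K = ⊤)
    (hJnontriv : Nontrivial J)
    (hJsimple : ∀ K : Submodule F J, (∀ a : J, ∀ x ∈ K, a * x ∈ K ∧ x * a ∈ K) → K = ⊥ ∨ K = ⊤)
    -- the (ℤ×G)-gradings
    (ΓI : ℤ × G → Submodule F I)
    (hIinternal : DirectSum.IsInternal ΓI)
    (hIone : (1 : I) ∈ ΓI (0, 1))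
    (hImul : ∀ p q : ℤ × G, ∀ x ∈ ΓI p, ∀ y ∈ ΓI q, x * y ∈ ΓI (p.1 + q.1, p.2 * q.2))
    (ΓJ : ℤ × G → Submodule F J)
    (hJinternal : DirectSum.IsInternal ΓJ)
    (hJone : (1 : J) ∈ ΓJ (0, 1))
    (hJmul : ∀ p q : ℤ × G, ∀ x ∈ ΓJ p, ∀ y ∈ ΓJ q, x * y ∈ ΓJ (p.1 + q.1, p.2 * q.2))
    -- both induced ℤ-gradings have support {−1,0,1}
    (hIsupp₁ : ∀ p : ℤ × G, ΓI p ≠ ⊥ → p.1 = -1 ∨ p.1 = 0 ∨ p.1 = 1)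
    (hIsupp₂ : ∃ g : G, ΓI (-1, g) ≠ ⊥) (hIsupp₃ : ∃ g : G, ΓI (0, g) ≠ ⊥)
    (hIsupp₄ : ∃ g : G, ΓI (1, g) ≠ ⊥)
    (hJsupp₁ : ∀ p : ℤ × G, ΓJ p ≠ ⊥ → p.1 = -1 ∨ p.1 = 0 ∨ p.1 = 1)
    (hJsupp₂ : ∃ g : G, ΓJ (-1, g) ≠ ⊥) (hJsupp₃ : ∃ g : G, ΓJ (0, g) ≠ ⊥)
    (hJsupp₄ : ∃ g : G, ΓJ (1, g) ≠ ⊥) :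
    -- (I ⊕ I^op, ex, Γ_I^ex) ≅ (J ⊕ J^op, ex, Γ_J^ex)  ↔  (I,Γ_I) ≅ (J,Γ_J) or (J^op,Γ_J^op)
    ((∃ e : (I × Iᵐᵒᵖ) ≃ₐ[F] (J × Jᵐᵒᵖ),
        (∀ x : I × Iᵐᵒᵖ, e (exInv F I x) = exInv F J (e x)) ∧
        (∀ p : ℤ × G, Submodule.map (e : (I × Iᵐᵒᵖ) →ₗ[F] (J × Jᵐᵒᵖ)) (exGr ΓI p)
            = exGr ΓJ p)) ↔
      ((∃ e : I ≃ₐ[F] J, ∀ p : ℤ × G, Submodule.map (e : I →ₗ[F] J) (ΓI p) = ΓJ p) ∨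
       (∃ e : I ≃ₐ[F] Jᵐᵒᵖ,
          ∀ p : ℤ × G, Submodule.map (e : I →ₗ[F] Jᵐᵒᵖ) (ΓI p) = opGr ΓJ p))) := by
  constructor
  · rintro ⟨e, hex, hgr⟩
    obtain ⟨a, b, hab⟩ : ∃ a b, e (1, 0) = (a, MulOpposite.op b) :=
      ⟨(e (1, 0)).1, (e (1, 0)).2.unop, rfl⟩
    have hba : e (0, 1) = (b, MulOpposite.op a) := by
      have h := hex (1, 0)
      rw [hab] at h
      exact h
    have hsum : a + b = 1 := by
      have h : e (1, 0) + e (0, 1) = 1 := by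
        rw [← map_add, ← map_one e]
        simp
      rw [hab, hba] at h
      exact congrArg Prod.fst h
    have hidem : a * a = a := by
      have h : e (1, 0) * e (1, 0) = e (1, 0) := by
        rw [← map_mul]
        simp
      rw [hab] at h
      exact congrArg Prod.fst h
    have hcentral : ∀ x, a * x = x * a := fun x => by
      have h : e (1, 0) * (x, 0) = (x, 0) * e (1, 0) := by
        apply e.symm.injective
        ext <;> simp
      rw [hab] at h
      exact congrArg Prod.fst h
    rcases eq_zero_or_eq_one_of_central_idempotent hJsimple hcentral hidem with rfl | rfl
    · obtain rfl : b = 1 := by simpa using hsum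
      right
      obtain ⟨f, hf⟩ := (e.trans (AlgEquiv.prodSwap J Jᵐᵒᵖ)).exists_fst_of_map_one_zero
        (by simp [hab])
      have hf' : ∀ x, e (x, 0) = (0, f x) := fun x => by
        simpa using congrArg Prod.swap (hf x)
      refine ⟨f, fun p => (f.map_submodule_eq_iff _ _).2 fun x => ?_⟩
      have h := (e.map_submodule_eq_iff _ _).1 (hgr p) (x, 0)
      rw [hf'] at h
      simpa [exGr, opGr, Submodule.mem_prod] using h
    · obtain rfl : b = 0 := by simpa using hsum
      left
      obtain ⟨f, hf⟩ := e.exists_fst_of_map_one_zero (by simp [hab])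
      refine ⟨f, fun p => (f.map_submodule_eq_iff _ _).2 fun x => ?_⟩
      have h := (e.map_submodule_eq_iff _ _).1 (hgr p) (x, 0)
      rw [hf] at h
      simpa [exGr, Submodule.mem_prod] using h
  · rintro (⟨f, hf⟩ | ⟨f, hf⟩)
    · refine ⟨AlgEquiv.prodCongr f (AlgEquiv.op f), fun x => rfl, fun p =>
        (AlgEquiv.map_submodule_eq_iff _ _ _).2 ?_⟩
      rintro ⟨x, y⟩
      have h₁ := (f.map_submodule_eq_iff _ _).1 (hf p) x
      have h₂ := (f.map_submodule_eq_iff _ _).1 (hf (-p.1, p.2)) y.unop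
      rw [exGr, exGr, Submodule.mem_prod, Submodule.mem_prod]
      refine and_congr h₁ ?_
      rw [mem_map_op_iff, mem_map_op_iff]
      exact h₂
    · refine ⟨(AlgEquiv.prodCongr f (AlgEquiv.opComm f)).trans (AlgEquiv.prodSwap Jᵐᵒᵖ J),
        fun x => rfl, fun p => (AlgEquiv.map_submodule_eq_iff _ _ _).2 ?_⟩
      rintro ⟨x, y⟩
      have h₁ := (f.map_submodule_eq_iff _ _).1 (hf p) x
      have h₂ := (f.map_submodule_eq_iff _ _).1 (hf (-p.1, p.2)) y.unop
      rw [exGr, exGr, Submodule.mem_prod, Submodule.mem_prod, and_comm]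
      rw [opGr, mem_map_op_iff] at h₁ h₂
      rw [neg_neg] at h₂
      refine and_congr ?_ ?_
      · rw [mem_map_op_iff]
        exact h₂
      · rw [mem_map_op_iff]
        exact h₁
end
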